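/- (Topological Tverberg type theorem for arbitrary $r$.) Let $r \geq 2$, $d \geq 1$ be integers, $N = (r-1)(d+1)$, and let $r = r_1 \cdots r_k$ be the prime power factorization of $r$ (so $r_j = p_j^{n_j}$ for distinct primes $p_j$), with $q_j = r/r_j$. Then for every continuous map $f : \Delta_N \to \mathbb{R}^d$ and every $j \in \{1,\dots,k\}$, there exist $r = q_j r_j$ pairwise disjoint faces of $\Delta_N$, grouped as $\{\sigma_{i_1},\dots,\sigma_{i_{r_j}}\}_{i=1}^{q_j}$, such that $f(\sigma_{i_1}) \cap \cdots \cap f(\sigma_{i_{r_j}}) \neq \emptyset$ for each $i = 1,\dots,q_j$. -/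

import Mathlib

/-- The closed face of the standard `N`-simplex spanned by the vertex set `S`. -/
def face (N : ℕ) (S : Finset (Fin (N + 1))) : Set (Fin (N + 1) → ℝ) :=
  {x | x ∈ stdSimplex ℝ (Fin (N + 1)) ∧ ∀ i, i ∉ S → x i = 0}

/-- The boundary `∂Δ_N` of the standard `N`-simplex. -/
def sBoundary (N : ℕ) : Set (Fin (N + 1) → ℝ) :=
  {x | x ∈ stdSimplex ℝ (Fin (N + 1)) ∧ ∃ i, x i = 0}

namespace ListChain

open Finsupp

variable {R X : Type*} [CommRing R]

/-- Prepending a vertex to every list of a chain. -/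
noncomputable def cone (x : X) : (List X →₀ R) →ₗ[R] (List X →₀ R) :=
  lmapDomain R R (List.cons x)

/-- The augmented alternating-sum boundary of a list of vertices. -/
noncomputable def bdryList (R : Type*) [CommRing R] : List X → (List X →₀ R)
  | [] => 0
  | x :: l => single l 1 - cone x (bdryList R l)

/-- The boundary operator on ordered chains. -/
noncomputable def bdry : (List X →₀ R) →ₗ[R] (List X →₀ R) :=
  linearCombination R (bdryList R)

/-- The chain map induced by a map of vertices. -/
noncomputable def mapChain (h : X → X) : (List X →₀ R) →ₗ[R] (List X →₀ R) :=
  lmapDomain R R (List.map h)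

/-- The prism over a list, interpolating between two maps of vertices. -/
noncomputable def prismList (R : Type*) [CommRing R] (h h' : X → X) :
    List X → (List X →₀ R)
  | [] => 0
  | x :: l => single (h x :: h' x :: l.map h') 1 - cone (h x) (prismList R h h' l)

/-- The prism operator on chains. -/
noncomputable def prism (h h' : X → X) : (List X →₀ R) →ₗ[R] (List X →₀ R) :=
  linearCombination R (prismList R h h')

@[simp] lemma cone_single (x : X) (l : List X) (a : R) :
    cone x (single l a) = single (x :: l) a := by
  simp [cone]

@[simp] lemma mapChain_single (h : X → X) (l : List X) (a : R) :
    mapChain h (single l a) = single (l.map h) a := by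
  simp [mapChain]

@[simp] lemma bdry_single (l : List X) (a : R) : bdry (single l a) = a • bdryList R l := by
  simp [bdry]

@[simp] lemma prism_single (h h' : X → X) (l : List X) (a : R) :
    prism h h' (single l a) = a • prismList R h h' l := by
  simp [prism]

lemma bdry_cone (x : X) (c : List X →₀ R) : bdry (cone x c) = c - cone x (bdry c) := by
  induction c using Finsupp.induction_linear with
  | zero => simp
  | add a b ha hb => simp only [map_add, ha, hb]; abel
  | single l a => simp [bdryList, smul_sub]

lemma bdry_bdryList (l : List X) : bdry (bdryList R l) = 0 := by
  induction l with
  | nil => simp [bdryList]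
  | cons x l ih => simp [bdryList, bdry_cone, ih]

lemma mapChain_cone (h : X → X) (x : X) (c : List X →₀ R) :
    mapChain h (cone x c) = cone (h x) (mapChain h c) := by
  induction c using Finsupp.induction_linear with
  | zero => simp
  | add a b ha hb => simp [ha, hb]
  | single l a => simp

lemma bdryList_map (h : X → X) (l : List X) :
    bdryList R (l.map h) = mapChain h (bdryList R l) := by
  induction l with
  | nil => simp [bdryList]
  | cons x l ih => simp [bdryList, mapChain_cone, ih]

lemma bdry_mapChain (h : X → X) (c : List X →₀ R) :
    bdry (mapChain h c) = mapChain h (bdry c) := by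
  induction c using Finsupp.induction_linear with
  | zero => simp
  | add a b ha hb => simp [ha, hb]
  | single l a => simp [bdryList_map]

lemma prism_cone (h h' : X → X) (x : X) (c : List X →₀ R) :
    prism h h' (cone x c) =
      cone (h x) (cone (h' x) (mapChain h' c)) - cone (h x) (prism h h' c) := by
  induction c using Finsupp.induction_linear with
  | zero => simp
  | add a b ha hb => simp only [map_add, ha, hb]; abel
  | single l a => simp [prismList, smul_sub]

lemma bdry_prismList (h h' : X → X) (l : List X) :
    bdry (prismList R h h' l) =
      single (l.map h') 1 - single (l.map h) 1 - prism h h' (bdryList R l) := by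
  induction l with
  | nil => simp [bdryList, prismList]
  | cons x l ih =>
    simp only [bdryList, prismList, map_sub, bdry_cone, prism_cone, bdry_single, one_smul,
      cone_single, prism_single, List.map_cons, ih, bdryList_map]
    abel

lemma bdry_prism (h h' : X → X) (c : List X →₀ R) :
    bdry (prism h h' c) = mapChain h' c - mapChain h c - prism h h' (bdry c) := by
  induction c using Finsupp.induction_linear with
  | zero => simp
  | add a b ha hb => simp only [map_add, ha, hb]; abel
  | single l a => simp [bdry_prismList, smul_sub]

/-- Chains whose lists satisfy a predicate stay controlled under linear maps. -/
lemma map_mem_supported {S T : Set (List X)} (φ : (List X →₀ R) →ₗ[R] (List X →₀ R))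
    (hφ : ∀ l ∈ S, φ (single l 1) ∈ supported R R T) {c : List X →₀ R}
    (hc : c ∈ supported R R S) : φ c ∈ supported R R T := by
  rw [supported_eq_span_single] at hc
  induction hc using Submodule.span_induction with
  | mem x hx => obtain ⟨l, hl, rfl⟩ := hx; exact hφ l hl
  | zero => simp
  | add x y _ _ hx hy => rw [map_add]; exact add_mem hx hy
  | smul a x _ hx => rw [map_smul]; exact Submodule.smul_mem _ _ hx

lemma cone_mem_supported {S T : Set (List X)} (x : X) (h : ∀ l ∈ S, x :: l ∈ T)
    {c : List X →₀ R} (hc : c ∈ supported R R S) : cone x c ∈ supported R R T :=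
  map_mem_supported _ (fun l hl => by
    rw [cone_single]; exact single_mem_supported R 1 (h l hl)) hc

lemma mapChain_mem_supported {S T : Set (List X)} (f : X → X) (h : ∀ l ∈ S, l.map f ∈ T)
    {c : List X →₀ R} (hc : c ∈ supported R R S) : mapChain f c ∈ supported R R T :=
  map_mem_supported _ (fun l hl => by
    rw [mapChain_single]; exact single_mem_supported R 1 (h l hl)) hc

lemma prismList_mem_supported (h h' : X → X) (l : List X) :
    prismList R h h' l ∈ supported R R {l' | ∀ x ∈ l', ∃ y ∈ l, x = h y ∨ x = h' y} := by
  induction l with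
  | nil => simp [prismList]
  | cons x l ih =>
    refine sub_mem (single_mem_supported R 1 ?_) (cone_mem_supported _ ?_ ih)
    · intro y hy
      simp only [List.mem_cons, List.mem_map] at hy
      rcases hy with rfl | rfl | ⟨z, hz, rfl⟩
      · exact ⟨x, by simp, .inl rfl⟩
      · exact ⟨x, by simp, .inr rfl⟩
      · exact ⟨z, by simp [hz], .inr rfl⟩
    · intro l' hl' y hy
      rcases List.mem_cons.1 hy with rfl | hy
      · exact ⟨x, by simp, .inl rfl⟩
      · obtain ⟨z, hz, h⟩ := hl' y hy
        exact ⟨z, by simp [hz], h⟩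

/-- A cycle is a boundary as soon as it can be contracted to a vertex `v` by finitely many
small moves. -/
lemma exists_bdry_eq {S T : Set (List X)} (h : ℕ → X → X) (M : ℕ) (v : X)
    (h0 : ∀ l ∈ S, ∀ x ∈ l, h 0 x = x) (hM : ∀ l ∈ S, ∀ x ∈ l, h M x = v)
    (hT : ∀ l ∈ S, ∀ k < M, ∀ l' : List X,
      (∀ x ∈ l', ∃ y ∈ l, x = h k y ∨ x = h (k + 1) y) → l' ∈ T)
    (hv : ∀ l : List X, (∀ x ∈ l, x = v) → l ∈ T)
    (c : List X →₀ R) (hc : c ∈ supported R R S) (hb : bdry c = 0) :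
    ∃ b ∈ supported R R T, bdry b = c := by
  have key (k : ℕ) (hk : k ≤ M) :
      ∃ b ∈ supported R R T, bdry b = mapChain (h k) c - c := by
    induction k with
    | zero =>
      refine ⟨0, zero_mem _, ?_⟩
      have := map_mem_supported (S := S) (T := ∅) (mapChain (h 0) - LinearMap.id) (fun l hl => by
        have : l.map (h 0) = l := by
          conv_rhs => rw [← List.map_id l]
          exact List.map_congr_left fun x hx => h0 l hl x hx
        simp [this]) hc
      rw [supported_empty, Submodule.mem_bot] at this
      rw [map_zero]
      exact this.symm
    | succ k ih =>
      obtain ⟨b, hbT, hbc⟩ := ih (by omega)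
      refine ⟨b + prism (h k) (h (k + 1)) c, add_mem hbT ?_, ?_⟩
      · refine map_mem_supported _ (fun l hl => ?_) hc
        rw [prism_single, one_smul]
        exact supported_mono (fun l' hl' => hT l hl k (by omega) l' hl')
          (prismList_mem_supported _ _ l)
      · rw [map_add, hbc, bdry_prism, hb, map_zero]; abel
  obtain ⟨b, hbT, hbc⟩ := key M le_rfl
  refine ⟨cone v (mapChain (h M) c) - b, sub_mem ?_ hbT, ?_⟩
  · refine cone_mem_supported (S := {l | ∀ x ∈ l, x = v}) v ?_ (mapChain_mem_supported _ ?_ hc)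
    · intro l hl
      exact hv _ (by simpa using hl)
    · intro l hl x hx
      obtain ⟨y, hy, rfl⟩ := List.mem_map.1 hx
      exact hM l hl y hy
  · rw [map_sub, bdry_cone, bdry_mapChain, hb, hbc]; simp

section Action

variable {G : Type*} [AddCommGroup G] [AddAction G X]

/-- The action of a group element on chains. -/
noncomputable def act (R : Type*) [CommRing R] (g : G) : Module.End R (List X →₀ R) :=
  mapChain (g +ᵥ ·)

lemma act_add (g h : G) : act (X := X) R (g + h) = act R g * act R h := by
  refine LinearMap.ext fun c => ?_
  induction c using Finsupp.induction_linear with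
  | zero => simp
  | add a b ha hb => rw [map_add, ha, hb, map_add]
  | single l a => simp [act, Function.comp_def, add_vadd]

lemma commute_act (g h : G) : Commute (act (X := X) R g) (act R h) := by
  rw [Commute, SemiconjBy, ← act_add, ← act_add, add_comm]

lemma commute_sub_one {M : Type*} [AddCommGroup M] [Module R M] {f g : Module.End R M}
    (h : Commute f g) : Commute (f - 1) g := by
  refine LinearMap.ext fun x => ?_
  have := LinearMap.congr_fun h.eq x
  simp only [Module.End.mul_apply] at this
  simp [this]

lemma bdry_act (g : G) (c : List X →₀ R) : bdry (act R g c) = act R g (bdry c) :=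
  bdry_mapChain _ _

variable (p : ℕ) [Fact p.Prime] [Module (ZMod p) G]

/-- The operators of the periodic resolution of a cyclic group of order `p`: the norm in even
degrees, the difference `g - 1` in odd degrees. -/
noncomputable def stepOp (R : Type*) [CommRing R] (g : G) (k : ℕ) :
    Module.End R (List X →₀ R) :=
  if Even k then ∑ a : ZMod p, act R (a • g) else act R g - 1

lemma bdry_stepOp (g : G) (k : ℕ) (c : List X →₀ R) :
    bdry (stepOp p R g k c) = stepOp p R g k (bdry c) := by
  unfold stepOp
  split_ifs <;> simp [bdry_act, LinearMap.sum_apply]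

lemma commute_stepOp (g h : G) (k k' : ℕ) :
    Commute (stepOp (X := X) p R g k) (stepOp p R h k') := by
  unfold stepOp
  split_ifs
  · exact Commute.sum_left _ _ _ fun a _ => Commute.sum_right _ _ _ fun b _ => commute_act _ _
  · exact Commute.sum_left _ _ _ fun a _ => (commute_sub_one (commute_act _ _)).symm
  · exact Commute.sum_right _ _ _ fun a _ => commute_sub_one (commute_act _ _)
  · refine commute_sub_one (commute_sub_one (commute_act _ _)).symm

lemma diff_mul_norm (g : G) :
    (act (X := X) R g - 1) * ∑ a : ZMod p, act R (a • g) = 0 := by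
  have h : act (X := X) R g * ∑ a : ZMod p, act R (a • g) = ∑ a : ZMod p, act R (a • g) := by
    rw [Finset.mul_sum]
    refine Fintype.sum_equiv (Equiv.addLeft 1) _ _ fun a => ?_
    rw [← act_add]
    simp [add_smul]
  refine LinearMap.ext fun c => ?_
  have := LinearMap.congr_fun h c
  exact sub_eq_zero.2 this

lemma stepOp_mul_stepOp (g : G) {k : ℕ} (hk : k ≠ 0) :
    stepOp (X := X) p R g k * stepOp p R g (k - 1) = 0 := by
  obtain ⟨k, rfl⟩ := Nat.exists_eq_succ_of_ne_zero hk
  have h := diff_mul_norm (R := R) (X := X) p g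
  rcases Nat.even_or_odd k with hk | hk
  · simp [stepOp, hk, Nat.even_add_one, h]
  · have h1 : Even (k + 1) := hk.add_one
    have h2 : ¬ Even k := by simpa using hk
    have hc : Commute (act (X := X) R g - 1) (∑ a : ZMod p, act R (a • g)) :=
      Commute.sum_right _ _ _ fun a _ => commute_sub_one (commute_act _ _)
    simp only [stepOp, Nat.succ_eq_add_one, h1, h2, if_true, if_false, Nat.add_sub_cancel]
    rw [← hc.eq, h]

lemma stepOp_one_nil (g : G) : stepOp (X := X) p R g 1 (single [] 1) = 0 := by
  simp [stepOp, act]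

lemma act_mem_supported {S : Set (List X)} (hS : ∀ (g : G), ∀ l ∈ S, l.map (g +ᵥ ·) ∈ S)
    (g : G) {c : List X →₀ R} (hc : c ∈ supported R R S) : act R g c ∈ supported R R S :=
  mapChain_mem_supported _ (hS g) hc

lemma stepOp_mem_supported {S : Set (List X)} (hS : ∀ (g : G), ∀ l ∈ S, l.map (g +ᵥ ·) ∈ S)
    (g : G) (k : ℕ) {c : List X →₀ R} (hc : c ∈ supported R R S) :
    stepOp p R g k c ∈ supported R R S := by
  unfold stepOp
  split_ifs
  · rw [LinearMap.sum_apply]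
    exact sum_mem fun a _ => act_mem_supported hS _ hc
  · exact sub_mem (act_mem_supported hS _ hc) hc

end Action

lemma sum_sum_eq_zero_of_antisymm {ι A : Type*} [Fintype ι] [AddCommGroup A]
    (f : ι → ι → A) (h0 : ∀ i, f i i = 0) (h : ∀ i j, i ≠ j → f i j + f j i = 0) :
    ∑ i, ∑ j, f i j = 0 := by
  rw [← Fintype.sum_prod_type']
  refine Finset.sum_involution (fun a _ => a.swap) ?_ ?_ (fun _ _ => Finset.mem_univ _)
    (fun _ _ => Prod.swap_swap _)
  · rintro ⟨i, j⟩ -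
    by_cases hij : i = j
    · subst hij; simp [h0]
    · exact h i j hij
  · rintro ⟨i, j⟩ - hf hij
    obtain rfl : j = i := congrArg Prod.fst hij
    exact hf (h0 _)

section Resolution

variable {n : ℕ}

/-- The Koszul sign of the `j`-th face of a multi-index. -/
def multiSign (R : Type*) [CommRing R] (j : Fin n) (m : Fin n →₀ ℕ) : R :=
  ∏ k ∈ Finset.Iio j, (-1) ^ m k

lemma multiSign_sub_of_lt {j i : Fin n} (hji : j < i) (m : Fin n →₀ ℕ) (hm : m j ≠ 0) :
    multiSign R i (m - single j 1) = - multiSign R i m := by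
  have hj : j ∈ Finset.Iio i := by simpa
  unfold multiSign
  rw [← Finset.mul_prod_erase _ _ hj, ← Finset.mul_prod_erase _ _ hj]
  obtain ⟨k, hk⟩ := Nat.exists_eq_succ_of_ne_zero hm
  have : ∏ x ∈ (Finset.Iio i).erase j, (-1 : R) ^ (m - single j 1 : Fin n →₀ ℕ) x =
      ∏ x ∈ (Finset.Iio i).erase j, (-1 : R) ^ m x :=
    Finset.prod_congr rfl fun x hx => by
      have : j ≠ x := (Finset.ne_of_mem_erase hx).symm
      simp [this]
  rw [this]
  simp [hk, pow_succ]

lemma multiSign_sub_of_ge {j i : Fin n} (hij : i ≤ j) (m : Fin n →₀ ℕ) :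
    multiSign R i (m - single j 1) = multiSign R i m := by
  refine Finset.prod_congr rfl fun x hx => ?_
  have : j ≠ x := by
    rintro rfl
    exact absurd (Finset.mem_Iio.1 hx) (not_lt.2 hij)
  simp [this]

lemma multiSign_antisymm {i j : Fin n} (hij : i ≠ j) (m : Fin n →₀ ℕ) (hi : m i ≠ 0)
    (hj : m j ≠ 0) :
    multiSign R j m * multiSign R i (m - single j 1) =
      - (multiSign R i m * multiSign R j (m - single i 1)) := by
  rcases lt_or_gt_of_ne hij with h | h
  · rw [multiSign_sub_of_ge h.le, multiSign_sub_of_lt h m hi]; ring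
  · rw [multiSign_sub_of_lt h m hj, multiSign_sub_of_ge h.le]; ring

lemma degree_sub_single (m : Fin n →₀ ℕ) {j : Fin n} (hj : m j ≠ 0) :
    (m - single j 1).degree + 1 = m.degree := by
  have h : m - single j 1 + single j 1 = m :=
    tsub_add_cancel_of_le (by rw [Finsupp.single_le_iff]; omega)
  conv_rhs => rw [← h, map_add, Finsupp.degree_single]

variable (p : ℕ) [Fact p.Prime] [AddAction (Fin n → ZMod p) X]

/-- The boundary prescribed by the tensor product of `n` periodic resolutions. -/
noncomputable def resBdry (z : (Fin n →₀ ℕ) → (List X →₀ R)) (m : Fin n →₀ ℕ) : List X →₀ R :=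
  ∑ j, if m j = 0 then 0 else
    multiSign R j m • stepOp p R (Pi.single j (1 : ZMod p) : Fin n → ZMod p) (m j)
      (z (m - single j 1))

lemma bdry_resBdry (z : (Fin n →₀ ℕ) → (List X →₀ R)) (m : Fin n →₀ ℕ)
    (hz : ∀ j, m j ≠ 0 → bdry (z (m - single j 1)) =
      resBdry p z (m - single j 1) + if m - single j 1 = 0 then single [] 1 else 0) :
    bdry (resBdry p z m) = 0 := by
  have hterm (j : Fin n) : bdry (if m j = 0 then 0 else
      multiSign R j m • stepOp p R (Pi.single j (1 : ZMod p) : Fin n → ZMod p) (m j)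
        (z (m - single j 1))) = ∑ i, if m j = 0 ∨ (m - single j 1 : Fin n →₀ ℕ) i = 0 then 0 else
        (multiSign R j m * multiSign R i (m - single j 1)) •
          stepOp p R (Pi.single j (1 : ZMod p) : Fin n → ZMod p) (m j)
            (stepOp p R (Pi.single i (1 : ZMod p) : Fin n → ZMod p)
              ((m - single j 1 : Fin n →₀ ℕ) i) (z (m - single j 1 - single i 1))) := by
    by_cases hj : m j = 0
    · simp [hj]
    have hnil : stepOp p R (Pi.single j (1 : ZMod p) : Fin n → ZMod p) (m j)
        (if m - single j 1 = 0 then single ([] : List X) 1 else 0) = 0 := by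
      split_ifs with h0
      · have h1 : m j = 1 := by
          have := DFunLike.congr_fun h0 j
          simp at this
          omega
        rw [h1, stepOp_one_nil]
      · simp
    rw [if_neg hj, map_smul, bdry_stepOp, hz j hj, map_add, hnil, add_zero, resBdry, map_sum,
      Finset.smul_sum]
    refine Finset.sum_congr rfl fun i _ => ?_
    simp only [hj, false_or]
    split_ifs
    · simp
    · rw [map_smul, smul_smul]
  rw [resBdry, map_sum, Finset.sum_congr rfl fun j _ => hterm j]
  refine sum_sum_eq_zero_of_antisymm _ (fun j => ?_) (fun j i hij => ?_)
  · split_ifs with h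
    · rfl
    · push Not at h
      have : (m - single j 1 : Fin n →₀ ℕ) j = m j - 1 := by simp
      rw [this, ← Module.End.mul_apply, stepOp_mul_stepOp p _ h.1]
      simp
  · have h1 : (m - single j 1 : Fin n →₀ ℕ) i = m i := by simp [hij]
    have h2 : (m - single i 1 : Fin n →₀ ℕ) j = m j := by simp [hij.symm]
    rw [h1, h2]
    by_cases hj : m j = 0
    · simp [hj]
    by_cases hi : m i = 0
    · simp [hi]
    rw [if_neg (by tauto), if_neg (by tauto), multiSign_antisymm hij.symm m hi hj,
      ← Module.End.mul_apply, (commute_stepOp p _ _ _ _).eq, Module.End.mul_apply,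
      tsub_right_comm, neg_smul, neg_add_cancel]

/-- A system of chains realising the tensor product of `n` periodic resolutions. -/
lemma exists_resolution (S : ℕ → Set (List X)) (N : ℕ)
    (hinv : ∀ k (g : Fin n → ZMod p), ∀ l ∈ S k, l.map (g +ᵥ ·) ∈ S k)
    (hfill : ∀ k < N, ∀ c ∈ supported R R (S k), bdry c = 0 →
      ∃ b ∈ supported R R (S (k + 1)), bdry b = c)
    (v : X) (hv : [v] ∈ S 0) :
    ∃ z : (Fin n →₀ ℕ) → (List X →₀ R), z 0 = single [v] 1 ∧
      ∀ m, m.degree ≤ N → z m ∈ supported R R (S m.degree) ∧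
        (m ≠ 0 → bdry (z m) = resBdry p z m) := by
  have hfill' : ∀ k c, ∃ b, k < N → c ∈ supported R R (S k) → bdry c = 0 →
      b ∈ supported R R (S (k + 1)) ∧ bdry b = c := by
    intro k c
    by_cases h : k < N ∧ c ∈ supported R R (S k) ∧ bdry c = 0
    · obtain ⟨b, hb⟩ := hfill k h.1 c h.2.1 h.2.2
      exact ⟨b, fun _ _ _ => hb⟩
    · exact ⟨0, fun h1 h2 h3 => absurd ⟨h1, h2, h3⟩ h⟩
  choose fill hfill using hfill'
  let Z : ℕ → (Fin n →₀ ℕ) → (List X →₀ R) := fun k =>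
    Nat.rec (fun _ => single [v] 1) (fun k Zk m => fill k (resBdry p Zk m)) k
  let z : (Fin n →₀ ℕ) → (List X →₀ R) := fun m => Z m.degree m
  have hz0 : z 0 = single [v] 1 := by simp [z, Z]
  have hzs (m : Fin n →₀ ℕ) (k : ℕ) (hm : m.degree = k + 1) : z m = fill k (resBdry p z m) := by
    have : resBdry p z m = resBdry p (Z k) m := by
      refine Finset.sum_congr rfl fun j _ => ?_
      by_cases hj : m j = 0
      · simp [hj]
      · have := degree_sub_single m hj
        have hk : (m - single j 1).degree = k := by omega
        simp only [z, hk]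
    rw [this]
    simp only [z, hm]
    rfl
  refine ⟨z, hz0, fun m => ?_⟩
  induction hk : m.degree generalizing m with
  | zero =>
    have : m = 0 := (Finsupp.degree_eq_zero_iff m).1 hk
    subst this
    exact fun _ => ⟨by rw [hz0]; exact single_mem_supported R 1 hv, fun h => absurd rfl h⟩
  | succ k ih =>
    intro hkN
    have hsub (j : Fin n) (hj : m j ≠ 0) : (m - single j 1).degree = k := by
      have := degree_sub_single m hj
      omega
    obtain ⟨h1, h2⟩ := hfill k (resBdry p z m) (by omega)
      (by
        refine sum_mem fun j _ => ?_
        split_ifs with hj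
        · exact zero_mem _
        · exact Submodule.smul_mem _ _ (stepOp_mem_supported p (hinv k) _ _
            (ih _ (hsub j hj) (by omega)).1))
      (bdry_resBdry p z m fun j hj => by
        by_cases h0 : m - single j 1 = 0
        · simp [h0, hz0, bdryList, resBdry]
        · rw [if_neg h0, add_zero, (ih _ (hsub j hj) (by omega)).2 h0])
    rw [hzs m k hk]
    exact ⟨h1, fun _ => h2⟩

end Resolution

section Cochain

/-- Evaluation of a cochain on chains. -/
noncomputable def ev (φ : List X → R) : (List X →₀ R) →ₗ[R] R :=
  linearCombination R φ

@[simp] lemma ev_single (φ : List X → R) (l : List X) (a : R) :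
    ev φ (single l a) = a * φ l := by
  simp [ev]

lemma ev_eq_zero {φ : List X → R} {S : Set (List X)} (hφ : ∀ l ∈ S, φ l = 0)
    {c : List X →₀ R} (hc : c ∈ supported R R S) : ev φ c = 0 := by
  rw [ev, linearCombination_apply]
  refine Finset.sum_eq_zero fun l hl => ?_
  simp only [hφ l ((mem_supported R c).1 hc hl), smul_zero]

lemma ev_mapChain (φ : List X → R) (h : X → X) (c : List X →₀ R) :
    ev φ (mapChain h c) = ev (fun l => φ (l.map h)) c := by
  induction c using Finsupp.induction_linear with
  | zero => simp
  | add a b ha hb => rw [map_add, map_add, ha, hb, map_add]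
  | single l a => simp

lemma ev_cone (φ : List X → R) (x : X) (c : List X →₀ R) :
    ev φ (cone x c) = ev (fun l => φ (x :: l)) c := by
  induction c using Finsupp.induction_linear with
  | zero => simp
  | add a b ha hb => rw [map_add, map_add, ha, hb, map_add]
  | single l a => simp

lemma ev_const_mul (r : R) (φ : List X → R) (c : List X →₀ R) :
    ev (fun l => r * φ l) c = r * ev φ c := by
  induction c using Finsupp.induction_linear with
  | zero => simp
  | add a b ha hb => rw [map_add, ha, hb, map_add, mul_add]
  | single l a => simp [mul_left_comm]

lemma ev_sum {ι : Type*} (s : Finset ι) (φ : ι → List X → R) (c : List X →₀ R) :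
    ∑ i ∈ s, ev (φ i) c = ev (fun l => ∑ i ∈ s, φ i l) c := by
  induction c using Finsupp.induction_linear with
  | zero => simp
  | add a b ha hb => simp only [map_add, Finset.sum_add_distrib, ha, hb]
  | single l a => simp [Finset.mul_sum]

lemma ev_sub (φ ψ : List X → R) (c : List X →₀ R) :
    ev φ c - ev ψ c = ev (fun l => φ l - ψ l) c := by
  induction c using Finsupp.induction_linear with
  | zero => simp
  | add a b ha hb => simp only [map_add, ← ha, ← hb]; ring
  | single l a => simp [mul_sub]

/-- A cochain vanishing on all boundaries. -/
def IsCocycle (w : List X → R) : Prop := ∀ l, ev w (bdryList R l) = 0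

lemma IsCocycle.nil {w : List X → R} (hw : IsCocycle w) (x : X) : w [] = 0 := by
  simpa [bdryList] using hw [x]

/-- Cup product of a `0`-cochain with a cochain. -/
def cup₀ (s : X → R) (w : List X → R) : List X → R
  | x :: l => s x * w (x :: l)
  | [] => 0

/-- Cup product of a `1`-cochain with a cochain. -/
def cup₁ (t : X → X → R) (w : List X → R) : List X → R
  | x :: y :: l => t x y * w (y :: l)
  | _ => 0

/-- Cup product of a `2`-cochain with a cochain. -/
def cup₂ (y : X → X → X → R) (w : List X → R) : List X → R
  | a :: b :: c :: l => y a b c * w (c :: l)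
  | _ => 0

/-- The coboundary of a `1`-cochain. -/
def coboundary (t : X → X → R) (a b c : X) : R := t b c - t a c + t a b

lemma ev_cup₀_bdryList (s : X → R) {w : List X → R} (hw : IsCocycle w) (l : List X) :
    ev (cup₀ s w) (bdryList R l) = cup₁ (fun x y => s y - s x) w l := by
  match l with
  | [] => simp [bdryList, cup₁]
  | [a] => simp [bdryList, cup₁, cup₀]
  | a :: b :: l =>
    have h := hw (b :: l)
    have h' := hw (a :: b :: l)
    simp only [bdryList, map_sub, ev_single, ev_cone, cone_single, one_mul, cup₀, cup₁,
      ev_const_mul] at h h' ⊢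
    linear_combination s a * h'

lemma ev_cup₁_bdryList (t : X → X → R) {w : List X → R} (hw : IsCocycle w) (l : List X) :
    ev (cup₁ t w) (bdryList R l) = cup₂ (coboundary t) w l := by
  match l with
  | [] => simp [bdryList, cup₂]
  | [a] => simp [bdryList, cup₂, cup₁]
  | [a, b] => simp [bdryList, cup₂, cup₁]
  | a :: b :: c :: l =>
    have h' := hw (b :: c :: l)
    simp only [bdryList, map_sub, ev_single, ev_cone, cone_single, one_mul, cup₁, cup₂,
      ev_const_mul, coboundary] at h' ⊢
    linear_combination -t a b * h'

lemma ev_cup₀_bdry (s : X → R) {w : List X → R} (hw : IsCocycle w) (c : List X →₀ R) :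
    ev (cup₀ s w) (bdry c) = ev (cup₁ (fun x y => s y - s x) w) c := by
  induction c using Finsupp.induction_linear with
  | zero => simp
  | add a b ha hb => simp [ha, hb]
  | single l a => simp [ev_cup₀_bdryList s hw]

lemma ev_cup₁_bdry (t : X → X → R) {w : List X → R} (hw : IsCocycle w) (c : List X →₀ R) :
    ev (cup₁ t w) (bdry c) = ev (cup₂ (coboundary t) w) c := by
  induction c using Finsupp.induction_linear with
  | zero => simp
  | add a b ha hb => simp [ha, hb]
  | single l a => simp [ev_cup₁_bdryList t hw]

lemma IsCocycle.cup₂_coboundary (t : X → X → R) {w : List X → R} (hw : IsCocycle w) :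
    IsCocycle (cup₂ (coboundary t) w) := fun l => by
  rw [← ev_cup₁_bdry t hw, bdry_bdryList, map_zero]

lemma cup₂_map {y : X → X → X → R} {w : List X → R} {h : X → X}
    (hy : ∀ a b c, y (h a) (h b) (h c) = y a b c) (hw : ∀ l : List X, w (l.map h) = w l)
    (l : List X) : cup₂ y w (l.map h) = cup₂ y w l := by
  match l with
  | [] => rfl
  | [_] => rfl
  | [_, _] => rfl
  | a :: b :: c :: l =>
    have := hw (c :: l)
    simp only [List.map_cons] at this
    simp [cup₂, hy, this]

end Cochain

section Carry

variable {p : ℕ} [Fact p.Prime]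

/-- The carry in the subtraction of the residues `s y` and `s x`. -/
def carry (s : X → ZMod p) (x y : X) : ℤ := if (s y).val < (s x).val then 1 else 0

lemma mul_carry (s : X → ZMod p) (x y : X) :
    p * carry s x y = (s y - s x).val - (s y).val + (s x).val := by
  unfold carry
  split_ifs with h
  · have h1 := ZMod.val_sub h.le
    have h2 : s x - s y ≠ 0 := by
      rw [sub_ne_zero]
      rintro h'
      simp [h'] at h
    have : NeZero (s x - s y) := ⟨h2⟩
    have h3 := ZMod.val_neg_of_ne_zero (s x - s y)
    rw [neg_sub] at h3
    have h4 := ZMod.val_lt (s x - s y)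
    omega
  · have := ZMod.val_sub (not_lt.1 h)
    omega

lemma sum_carry (s : ZMod p → X → ZMod p) (x y : X) (c : ZMod p) (hc : c ≠ 0)
    (hs : ∀ a z, s a z = s 0 z + a * c) :
    ∑ a, (carry (s a) x y : ZMod p) = s 0 y - s 0 x := by
  have key : ∑ a, carry (s a) x y = (s 0 y - s 0 x).val := by
    have hp : (p : ℤ) ≠ 0 := by exact_mod_cast (Fact.out : p.Prime).ne_zero
    have hsum (z : X) : ∑ a, ((s a z).val : ℤ) = ∑ a : ZMod p, (a.val : ℤ) := by
      let e : ZMod p ≃ ZMod p := (Equiv.mulRight₀ c hc).trans (Equiv.addLeft (s 0 z))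
      exact Fintype.sum_equiv e _ _ fun a => by rw [hs a z]; rfl
    apply mul_left_cancel₀ hp
    rw [Finset.mul_sum, Finset.sum_congr rfl fun a _ => mul_carry (s a) x y,
      Finset.sum_add_distrib, Finset.sum_sub_distrib, hsum, hsum, sub_add_cancel]
    have : ∀ a, s a y - s a x = s 0 y - s 0 x := fun a => by rw [hs a y, hs a x]; ring
    simp [this, ZMod.card]
  have := congrArg (Int.cast : ℤ → ZMod p) key
  push_cast at this
  simpa using this

lemma coboundary_carry_congr {s : X → ZMod p} {h : X → X} {c : ZMod p}
    (hs : ∀ x, s (h x) = s x + c) (a b d : X) :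
    coboundary (carry s) (h a) (h b) (h d) = coboundary (carry s) a b d := by
  have hp : (p : ℤ) ≠ 0 := by exact_mod_cast (Fact.out : p.Prime).ne_zero
  apply mul_left_cancel₀ hp
  simp only [coboundary, mul_add, mul_sub, mul_carry, hs, add_sub_add_right_eq_sub]
  ring

/-- The `1`-cochain whose coboundary represents the Euler class of a character, corrected by
`η`. -/
def eulerPrim (s : X → ZMod p) (η : X → X → ZMod p) (x y : X) : ZMod p :=
  carry s x y - η x y

lemma coboundary_eulerPrim_congr {s : X → ZMod p} {η : X → X → ZMod p} {h : X → X} {c : ZMod p}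
    (hs : ∀ x, s (h x) = s x + c) (hη : ∀ x y, η (h x) (h y) = η x y) (a b d : X) :
    coboundary (eulerPrim s η) (h a) (h b) (h d) = coboundary (eulerPrim s η) a b d := by
  have := congrArg (Int.cast : ℤ → ZMod p) (coboundary_carry_congr hs a b d)
  simp only [coboundary, eulerPrim, hη] at this ⊢
  push_cast at this
  linear_combination this

variable {n : ℕ} [AddAction (Fin n → ZMod p) X]

lemma ev_norm (φ : List X → ZMod p) (g : Fin n → ZMod p) {k : ℕ} (hk : Even k)
    (c : List X →₀ ZMod p) :
    ev φ (stepOp p (ZMod p) g k c) = ev (fun l => ∑ a : ZMod p, φ (l.map ((a • g) +ᵥ ·))) c := by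
  rw [stepOp, if_pos hk, LinearMap.sum_apply, map_sum, ← ev_sum]
  exact Finset.sum_congr rfl fun a _ => ev_mapChain _ _ _

lemma ev_diff (φ : List X → ZMod p) (g : Fin n → ZMod p) {k : ℕ} (hk : ¬ Even k)
    (c : List X →₀ ZMod p) :
    ev φ (stepOp p (ZMod p) g k c) = ev (fun l => φ (l.map (g +ᵥ ·)) - φ l) c := by
  rw [stepOp, if_neg hk, ← ev_sub, ← ev_mapChain, ← map_sub]
  rfl

variable {χ : Fin n → ZMod p} {s : X → ZMod p} {η : X → X → ZMod p} {w : List X → ZMod p}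

lemma ev_cup₁_norm (hs : ∀ g x, s (g +ᵥ x) = s x + χ ⬝ᵥ g)
    (hη : ∀ (g : Fin n → ZMod p) x y, η (g +ᵥ x) (g +ᵥ y) = η x y)
    (hwi : ∀ (g : Fin n → ZMod p) l, w (l.map (g +ᵥ ·)) = w l) (hw : IsCocycle w)
    (j : Fin n) {k : ℕ} (hk : Even k) (c : List X →₀ ZMod p) :
    ev (cup₁ (eulerPrim s η) w) (stepOp p (ZMod p) (Pi.single j (1 : ZMod p) : Fin n → ZMod p) k c)
      = if χ j = 0 then 0 else ev (cup₀ s w) (bdry c) := by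
  have hs' (a : ZMod p) (x : X) :
      s ((a • (Pi.single j 1 : Fin n → ZMod p)) +ᵥ x) = s x + a * χ j := by
    rw [hs, dotProduct_smul, dotProduct_single, smul_eq_mul, mul_one]
  rw [ev_norm _ _ hk]
  have key (l : List X) : ∑ a : ZMod p, cup₁ (eulerPrim s η) w
      (l.map ((a • (Pi.single j 1 : Fin n → ZMod p)) +ᵥ ·)) =
      (if χ j = 0 then 0 else 1) * cup₁ (fun x y => s y - s x) w l := by
    match l with
    | [] => simp [cup₁]
    | [_] => simp [cup₁]
    | x :: y :: l =>
      have h1 (a : ZMod p) : cup₁ (eulerPrim s η) w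
          ((x :: y :: l).map ((a • (Pi.single j 1 : Fin n → ZMod p)) +ᵥ ·)) =
          ((carry (fun z => s z + a * χ j) x y : ZMod p) - η x y) * w (y :: l) := by
        rw [List.map_cons, List.map_cons, cup₁, ← List.map_cons, hwi, eulerPrim, hη]
        simp only [carry, hs']
      rw [Finset.sum_congr rfl fun a _ => h1 a, ← Finset.sum_mul, Finset.sum_sub_distrib, cup₁]
      split_ifs with h0
      · simp [h0, ZMod.card]
      · rw [sum_carry (fun a z => s z + a * χ j) x y (χ j) h0 (fun a z => by simp)]
        simp [ZMod.card]
  simp only [key, ev_const_mul, ev_cup₀_bdry s hw]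
  split_ifs <;> simp

lemma ev_cup₀_diff [Nonempty X] (hs : ∀ g x, s (g +ᵥ x) = s x + χ ⬝ᵥ g)
    (hwi : ∀ (g : Fin n → ZMod p) l, w (l.map (g +ᵥ ·)) = w l) (hw : IsCocycle w)
    (j : Fin n) {k : ℕ} (hk : ¬ Even k) (c : List X →₀ ZMod p) :
    ev (cup₀ s w) (stepOp p (ZMod p) (Pi.single j (1 : ZMod p) : Fin n → ZMod p) k c)
      = χ j * ev w c := by
  rw [ev_diff _ _ hk, ← ev_const_mul]
  congr 2
  funext l
  match l with
  | [] => simp [cup₀, hw.nil (Classical.arbitrary X)]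
  | x :: l =>
    rw [List.map_cons, cup₀, ← List.map_cons, hwi, hs, cup₀, dotProduct_single]
    ring

lemma ev_cup₀_norm [Nonempty X] (hs : ∀ g x, s (g +ᵥ x) = s x + χ ⬝ᵥ g)
    (hwi : ∀ (g : Fin n → ZMod p) l, w (l.map (g +ᵥ ·)) = w l) (hw : IsCocycle w)
    (j : Fin n) {k : ℕ} (hk : Even k) (c : List X →₀ ZMod p) :
    ev (cup₀ s w) (stepOp p (ZMod p) (Pi.single j (1 : ZMod p) : Fin n → ZMod p) k c)
      = χ j * (∑ a : ZMod p, a) * ev w c := by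
  rw [ev_norm _ _ hk, ← ev_const_mul]
  congr 2
  funext l
  match l with
  | [] => simp [cup₀, hw.nil (Classical.arbitrary X)]
  | x :: l =>
    have h1 (a : ZMod p) : cup₀ s w
        ((x :: l).map ((a • (Pi.single j 1 : Fin n → ZMod p)) +ᵥ ·)) =
        (s x + χ j * a) * w (x :: l) := by
      rw [List.map_cons, cup₀, ← List.map_cons, hwi, hs, dotProduct_smul, dotProduct_single,
        smul_eq_mul, mul_one, mul_comm a]
    rw [Finset.sum_congr rfl fun a _ => h1 a, ← Finset.sum_mul, Finset.sum_add_distrib,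
      ← Finset.mul_sum]
    simp [ZMod.card]

/-- The indicator of nonzero residues can be replaced by the identity in front of the sum of all
residues. -/
lemma sum_univ_mul_eq (c x : ZMod p) :
    (if c = 0 then 0 else x * ∑ a : ZMod p, a) = c * x * ∑ a : ZMod p, a := by
  rcases (Fact.out : p.Prime).eq_two_or_odd' with rfl | hodd
  · by_cases hc : c = 0
    · simp [hc]
    · have h1 : c = (1 : ZMod 2) := Fin.eq_one_of_ne_zero c hc
      rw [if_neg hc, h1, one_mul]
  · have : ∑ a : ZMod p, a = 0 := by
      have h2 : (2 : ZMod p) ≠ 0 := by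
        intro h
        have h' : ((2 : ℕ) : ZMod p) = 0 := by exact_mod_cast h
        rw [ZMod.natCast_eq_zero_iff] at h'
        have := Nat.le_of_dvd (by norm_num) h'
        have := (Fact.out : p.Prime).two_le
        obtain rfl : p = 2 := by omega
        exact absurd hodd (by decide)
      have h : ∑ a : ZMod p, a = - ∑ a : ZMod p, a := by
        rw [← Finset.sum_neg_distrib]
        exact Fintype.sum_equiv (Equiv.neg _) _ _ fun a => by simp
      have : (2 : ZMod p) * ∑ a : ZMod p, a = 0 := by linear_combination h
      exact (mul_eq_zero.1 this).resolve_left h2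
    simp [this]

lemma multiSign_two_smul (j : Fin n) (a : Fin n →₀ ℕ) :
    multiSign (ZMod p) j (2 • a) = 1 :=
  Finset.prod_eq_one fun k _ => by simp [pow_mul]

/-- Cap product of the resolution with the Euler class of a character. -/
lemma ev_cup₂_euler [Nonempty X] (hs : ∀ g x, s (g +ᵥ x) = s x + χ ⬝ᵥ g)
    (hη : ∀ (g : Fin n → ZMod p) x y, η (g +ᵥ x) (g +ᵥ y) = η x y)
    (hwi : ∀ (g : Fin n → ZMod p) l, w (l.map (g +ᵥ ·)) = w l) (hw : IsCocycle w)
    {z : (Fin n →₀ ℕ) → (List X →₀ ZMod p)} {N : ℕ}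
    (hz : ∀ m, m.degree ≤ N → m ≠ 0 → bdry (z m) = resBdry p z m)
    {a : Fin n →₀ ℕ} (ha : a ≠ 0) (haN : (2 • a).degree ≤ N) :
    ev (cup₂ (coboundary (eulerPrim s η)) w) (z (2 • a)) =
      ∑ j, if a j = 0 then 0 else χ j * ev w (z (2 • (a - single j 1))) := by
  let B : Fin n → Fin n → ZMod p := fun j i =>
    if i = j ∨ a j = 0 ∨ a i = 0 then 0 else
      multiSign (ZMod p) i (2 • a - single j 1) *
        (χ j * χ i * (∑ b : ZMod p, b) * ev w (z (2 • a - single j 1 - single i 1)))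
  have hB : ∑ j, ∑ i, B j i = 0 := by
    refine sum_sum_eq_zero_of_antisymm _ (fun j => by simp [B]) fun j i hij => ?_
    simp only [B, hij, hij.symm, false_or]
    by_cases hj : a j = 0
    · simp [hj]
    by_cases hi : a i = 0
    · simp [hi]
    have hsgn := multiSign_antisymm (R := ZMod p) hij (2 • a) (by simpa using hj)
      (by simpa using hi)
    rw [multiSign_two_smul, multiSign_two_smul, one_mul, one_mul] at hsgn
    rw [if_neg (by tauto), if_neg (by tauto), hsgn, tsub_right_comm]
    ring
  have hterm (j : Fin n) (hj : a j ≠ 0) : (if χ j = 0 then 0 else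
      ev (cup₀ s w) (bdry (z (2 • a - single j 1)))) =
      χ j * ev w (z (2 • (a - single j 1))) + ∑ i, B j i := by
    have hdeg := degree_sub_single (2 • a) (j := j) (by simpa using hj)
    have hne : (2 • a - single j 1 : Fin n →₀ ℕ) ≠ 0 := fun h => by
      have := DFunLike.congr_fun h j
      simp at this
      omega
    have h2 : (2 • a - single j 1 - single j 1 : Fin n →₀ ℕ) = 2 • (a - single j 1) := by
      ext i
      by_cases h : j = i
      · subst h; simp; omega
      · simp [h]
    rw [hz _ (by omega) hne, resBdry, map_sum]
    have hi (i : Fin n) : (if χ j = 0 then 0 else ev (cup₀ s w)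
        (if (2 • a - single j 1 : Fin n →₀ ℕ) i = 0 then 0 else
          multiSign (ZMod p) i (2 • a - single j 1) •
            stepOp p (ZMod p) (Pi.single i (1 : ZMod p) : Fin n → ZMod p)
              ((2 • a - single j 1 : Fin n →₀ ℕ) i) (z (2 • a - single j 1 - single i 1)))) =
        (if i = j then χ j * ev w (z (2 • (a - single j 1))) else 0) + B j i := by
      by_cases hij : i = j
      · subst hij
        have hodd : ¬ Even ((2 • a - single i 1 : Fin n →₀ ℕ) i) := by
          simp only [Finsupp.coe_tsub, Finsupp.coe_smul, Pi.sub_apply, Pi.smul_apply,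
            smul_eq_mul, single_eq_same, Nat.not_even_iff_odd]
          exact ⟨a i - 1, by omega⟩
        have h0 : (2 • a - single i 1 : Fin n →₀ ℕ) i ≠ 0 := fun h => hodd (by simp [h])
        rw [if_neg h0, map_smul, ev_cup₀_diff hs hwi hw i hodd, h2,
          multiSign_sub_of_ge le_rfl, multiSign_two_smul, one_smul]
        simp only [B, true_or, if_true, add_zero]
        split_ifs with h
        · simp [h]
        · rfl
      · have hval : (2 • a - single j 1 : Fin n →₀ ℕ) i = 2 * a i := by
          simp [Ne.symm hij]
        rw [hval]
        by_cases hai : a i = 0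
        · simp [hai, B, hij]
        · have h0 : 2 * a i ≠ 0 := by omega
          rw [if_neg h0, if_neg hij, zero_add, map_smul,
            ev_cup₀_norm hs hwi hw i (even_two_mul _), smul_eq_mul]
          simp only [B, hij, hj, hai, false_or, if_false, ← sum_univ_mul_eq]
          split_ifs <;> ring
    have : (if χ j = 0 then 0 else ∑ i, ev (cup₀ s w)
        (if (2 • a - single j 1 : Fin n →₀ ℕ) i = 0 then 0 else
          multiSign (ZMod p) i (2 • a - single j 1) •
            stepOp p (ZMod p) (Pi.single i (1 : ZMod p) : Fin n → ZMod p)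
              ((2 • a - single j 1 : Fin n →₀ ℕ) i) (z (2 • a - single j 1 - single i 1)))) =
        ∑ i, ((if i = j then χ j * ev w (z (2 • (a - single j 1))) else 0) + B j i) := by
      rw [← Finset.sum_congr rfl fun i _ => hi i]
      split_ifs <;> simp
    rw [this, Finset.sum_add_distrib]
    simp
  rw [← ev_cup₁_bdry _ hw, hz _ haN (by simpa using ha), resBdry, map_sum]
  have hj (j : Fin n) : ev (cup₁ (eulerPrim s η) w) (if (2 • a) j = 0 then 0 else
      multiSign (ZMod p) j (2 • a) • stepOp p (ZMod p)
        (Pi.single j (1 : ZMod p) : Fin n → ZMod p) ((2 • a) j) (z (2 • a - single j 1))) =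
      (if a j = 0 then 0 else χ j * ev w (z (2 • (a - single j 1)))) + ∑ i, B j i := by
    by_cases hj : a j = 0
    · simp [hj, B]
    · have h0 : (2 • a) j ≠ 0 := by simpa using hj
      rw [if_neg h0, if_neg hj, multiSign_two_smul, one_smul,
        ev_cup₁_norm hs hη hwi hw j (by simp), hterm j hj]
  rw [Finset.sum_congr rfl fun j _ => hj j, Finset.sum_add_distrib, hB, add_zero]

end Carry

section EulerProduct

variable {p : ℕ} [Fact p.Prime]

/-- The cocycle that is constant `1` on vertices. -/
def unitCocycle (R : Type*) [CommRing R] : List X → R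
  | [_] => 1
  | _ => 0

lemma isCocycle_unitCocycle (R : Type*) [CommRing R] :
    IsCocycle (unitCocycle R : List X → R) := fun l => by
  match l with
  | [] => simp [bdryList]
  | [_] => simp [bdryList, unitCocycle]
  | [_, _] => simp [bdryList, unitCocycle]
  | _ :: _ :: _ :: l =>
    simp only [bdryList, map_sub, cone_single, ev_single, ev_cone, unitCocycle, mul_zero,
      zero_sub, neg_neg]
    rw [ev_eq_zero (S := Set.univ) (by simp) (by simp), neg_zero]

variable {ι : Type*} (s : ι → X → ZMod p) (η : ι → X → X → ZMod p)

/-- The cup product of Euler cocycles. -/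
def eulerProd : List ι → List X → ZMod p
  | [] => unitCocycle (ZMod p)
  | i :: is => cup₂ (coboundary (eulerPrim (s i) (η i))) (eulerProd is)

lemma isCocycle_eulerProd (is : List ι) : IsCocycle (eulerProd s η is) := by
  induction is with
  | nil => exact isCocycle_unitCocycle _
  | cons i is ih => exact ih.cup₂_coboundary _

lemma exists_coboundary_ne_zero (is : List ι) (l : List X) (h : eulerProd s η is l ≠ 0) :
    ∀ i ∈ is, ∃ a ∈ l, ∃ b ∈ l, ∃ c ∈ l, coboundary (eulerPrim (s i) (η i)) a b c ≠ 0 := by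
  induction is generalizing l with
  | nil => simp
  | cons i is ih =>
    match l with
    | [] => simp [eulerProd, cup₂] at h
    | [_] => simp [eulerProd, cup₂] at h
    | [_, _] => simp [eulerProd, cup₂] at h
    | a :: b :: c :: l =>
      simp only [eulerProd, cup₂] at h
      intro k hk
      rcases List.mem_cons.1 hk with rfl | hk
      · exact ⟨a, by simp, b, by simp, c, by simp, left_ne_zero_of_mul h⟩
      · obtain ⟨x, hx, y, hy, z, hz, hne⟩ := ih _ (right_ne_zero_of_mul h) k hk
        exact ⟨x, List.mem_cons_of_mem _ (List.mem_cons_of_mem _ hx),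
          y, List.mem_cons_of_mem _ (List.mem_cons_of_mem _ hy),
          z, List.mem_cons_of_mem _ (List.mem_cons_of_mem _ hz), hne⟩

variable {n : ℕ}

/-- The linear form with given coefficients. -/
noncomputable def linForm (χ : Fin n → ZMod p) : MvPolynomial (Fin n) (ZMod p) :=
  ∑ j, MvPolynomial.C (χ j) * MvPolynomial.X j

lemma coeff_linForm_mul (χ : Fin n → ZMod p) (P : MvPolynomial (Fin n) (ZMod p))
    (a : Fin n →₀ ℕ) : (linForm χ * P).coeff a =
      ∑ j, if a j = 0 then 0 else χ j * P.coeff (a - single j 1) := by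
  rw [linForm, Finset.sum_mul, MvPolynomial.coeff_sum]
  refine Finset.sum_congr rfl fun j _ => ?_
  rw [mul_assoc, MvPolynomial.coeff_C_mul, MvPolynomial.coeff_X_mul']
  by_cases h : a j = 0 <;> simp [h]

lemma linForm_ne_zero {χ : Fin n → ZMod p} (h : χ ≠ 0) : linForm χ ≠ 0 := by
  obtain ⟨j, hj⟩ := Function.ne_iff.1 h
  intro h0
  have := coeff_linForm_mul χ 1 (single j 1)
  rw [h0, zero_mul, MvPolynomial.coeff_zero, Finset.sum_eq_single j] at this
  · simp at this
    exact hj this.symm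
  · intro i _ hi
    simp [Ne.symm hi]
  · simp

lemma isHomogeneous_linForm (χ : Fin n → ZMod p) : (linForm χ).IsHomogeneous 1 :=
  MvPolynomial.IsHomogeneous.sum _ _ _ fun j _ => by
    simpa using (MvPolynomial.isHomogeneous_C (Fin n) (χ j)).mul
      (MvPolynomial.isHomogeneous_X (ZMod p) j)

variable [AddAction (Fin n → ZMod p) X] {s η} {χ : ι → Fin n → ZMod p}

lemma eulerProd_map (hs : ∀ i g x, s i (g +ᵥ x) = s i x + χ i ⬝ᵥ g)
    (hη : ∀ i (g : Fin n → ZMod p) x y, η i (g +ᵥ x) (g +ᵥ y) = η i x y) (is : List ι)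
    (g : Fin n → ZMod p) (l : List X) :
    eulerProd s η is (l.map (g +ᵥ ·)) = eulerProd s η is l := by
  induction is generalizing l with
  | nil =>
    match l with
    | [] => rfl
    | [_] => rfl
    | _ :: _ :: _ => rfl
  | cons i is ih =>
    exact cup₂_map (coboundary_eulerPrim_congr (fun x => hs i g x) (hη i g)) ih l

lemma ev_eulerProd [Nonempty X] (hs : ∀ i g x, s i (g +ᵥ x) = s i x + χ i ⬝ᵥ g)
    (hη : ∀ i (g : Fin n → ZMod p) x y, η i (g +ᵥ x) (g +ᵥ y) = η i x y)
    {z : (Fin n →₀ ℕ) → (List X →₀ ZMod p)} {v : X} (hz0 : z 0 = single [v] 1) {N : ℕ}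
    (hz : ∀ m, m.degree ≤ N → m ≠ 0 → bdry (z m) = resBdry p z m) (is : List ι)
    (a : Fin n →₀ ℕ) (ha : a.degree = is.length) (haN : (2 • a).degree ≤ N) :
    ev (eulerProd s η is) (z (2 • a)) = (is.map fun i => linForm (χ i)).prod.coeff a := by
  induction is generalizing a with
  | nil =>
    obtain rfl := (Finsupp.degree_eq_zero_iff a).1 ha
    simp [hz0, eulerProd, unitCocycle]
  | cons i is ih =>
    have ha0 : a ≠ 0 := by
      rintro rfl
      simp at ha
    rw [List.map_cons, List.prod_cons, coeff_linForm_mul, eulerProd,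
      ev_cup₂_euler (hs i) (hη i) (eulerProd_map hs hη is) (isCocycle_eulerProd s η is) hz ha0 haN]
    refine Finset.sum_congr rfl fun j _ => ?_
    split_ifs with hj
    · rfl
    · have := degree_sub_single a hj
      rw [List.length_cons] at ha
      rw [ih _ (by omega)]
      simp only [map_nsmul, smul_eq_mul] at haN ⊢
      omega

/-- If the lists in `S N` span the top chains of an `N`-dimensional, `(N-1)`-connected free
complex, then a product of `N / 2` Euler classes of nonzero characters is nonzero on some of
them. -/
theorem exists_mem_forall_coboundary_ne_zero [Nonempty X] [Fintype ι]
    (hχ : ∀ i, χ i ≠ 0) (hs : ∀ i g x, s i (g +ᵥ x) = s i x + χ i ⬝ᵥ g)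
    (hη : ∀ i (g : Fin n → ZMod p) x y, η i (g +ᵥ x) (g +ᵥ y) = η i x y)
    (S : ℕ → Set (List X)) (N : ℕ) (hN : N = 2 * Fintype.card ι)
    (hinv : ∀ k (g : Fin n → ZMod p), ∀ l ∈ S k, l.map (g +ᵥ ·) ∈ S k)
    (hfill : ∀ k < N, ∀ c ∈ supported (ZMod p) (ZMod p) (S k), bdry c = 0 →
      ∃ b ∈ supported (ZMod p) (ZMod p) (S (k + 1)), bdry b = c)
    (v : X) (hv : [v] ∈ S 0) :
    ∃ l ∈ S N, ∀ i, ∃ a ∈ l, ∃ b ∈ l, ∃ c ∈ l,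
      coboundary (eulerPrim (s i) (η i)) a b c ≠ 0 := by
  obtain ⟨z, hz0, hz⟩ := exists_resolution p S N hinv hfill v hv
  let is : List ι := Finset.univ.toList
  have his : is.length = Fintype.card ι := by simp [is]
  let P := (is.map fun i => linForm (χ i)).prod
  have hP : P ≠ 0 := List.prod_ne_zero (by
    simp only [List.mem_map, not_exists, not_and]
    exact fun i _ => linForm_ne_zero (hχ i))
  obtain ⟨a, ha⟩ := MvPolynomial.ne_zero_iff.1 hP
  have hdeg : a.degree = is.length := by
    have hhom (is : List ι) :
        (is.map fun i => linForm (χ i)).prod.IsHomogeneous is.length := by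
      induction is with
      | nil => exact MvPolynomial.isHomogeneous_one _ _
      | cons i is ih =>
        rw [List.map_cons, List.prod_cons, List.length_cons, add_comm]
        exact (isHomogeneous_linForm _).mul ih
    by_contra h
    exact ha ((hhom is).coeff_eq_zero h)
  have h2 : (2 • a).degree = N := by
    rw [map_nsmul, hdeg, his, hN, smul_eq_mul]
  have hev := ev_eulerProd hs hη hz0 (fun m hm => (hz m hm).2) is a hdeg h2.le
  by_contra! hcon
  refine ha (hev ▸ ev_eq_zero (S := S N) (fun l hl => ?_) (h2 ▸ (hz (2 • a) h2.le).1))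
  by_contra hne
  obtain ⟨i, hi⟩ := hcon l hl
  obtain ⟨x, hx, y, hy, w, hw, h⟩ := exists_coboundary_ne_zero s η is l hne i (by simp [is])
  exact h (hi x hx y hy w hw)

end EulerProduct

end ListChain

namespace ChessJoin

open Finsupp ListChain

/-- The `N + 1`-fold join of the discrete set `G`, realised in `ℝ^((N+1) × G)`: convex
combinations of at most one element of each of the `N + 1` copies of `G`. -/
def chess (N : ℕ) (G : Type*) [Fintype G] : Set (Fin (N + 1) × G → ℝ) :=
  {x | (∀ a, 0 ≤ x a) ∧ ∑ a, x a = 1 ∧ ∀ i g h, x (i, g) ≠ 0 → x (i, h) ≠ 0 → g = h}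

variable {N : ℕ} {G : Type*} [Fintype G]

lemma chess_le_one (x : chess N G) (a : Fin (N + 1) × G) : x.1 a ≤ 1 := by
  rw [← x.2.2.1]
  exact Finset.single_le_sum (fun b _ => x.2.1 b) (Finset.mem_univ a)

lemma isCompact_chess : IsCompact (chess N G) := by
  refine (isCompact_univ_pi (s := fun _ : Fin (N + 1) × G => Set.Icc (0 : ℝ) 1)
    fun _ => isCompact_Icc).of_isClosed_subset ?_
    fun x hx a _ => ⟨hx.1 a, chess_le_one ⟨x, hx⟩ a⟩
  have : chess N G = (⋂ a, {x | 0 ≤ x a}) ∩ ({x | ∑ a, x a = 1} ∩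
      ⋂ i, ⋂ g, ⋂ h, {x | g = h ∨ x (i, g) * x (i, h) = 0}) := by
    ext x
    simp only [chess, Set.mem_ofPred_eq, Set.mem_inter_iff, Set.mem_iInter, mul_eq_zero]
    refine and_congr_right fun _ => and_congr_right fun _ => ?_
    refine forall_congr' fun i => forall_congr' fun g => forall_congr' fun h => ?_
    tauto
  rw [this]
  refine (isClosed_iInter fun a => isClosed_le continuous_const (continuous_apply a)).inter
    ((isClosed_eq (by fun_prop) continuous_const).inter
    (isClosed_iInter fun i => isClosed_iInter fun g => isClosed_iInter fun h => ?_))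
  by_cases hgh : g = h
  · simp [hgh]
  · simp only [hgh, false_or]
    exact isClosed_eq (by fun_prop) continuous_const

instance : CompactSpace (chess N G) := isCompact_iff_compactSpace.1 isCompact_chess

lemma exists_ne_zero (x : chess N G) : ∃ i g, x.1 (i, g) ≠ 0 := by
  by_contra! h
  have := x.2.2.1
  rw [Finset.sum_eq_zero fun a _ => h a.1 a.2] at this
  exact zero_ne_one this

section Action

variable [AddCommGroup G]

instance : AddAction G (chess N G) where
  vadd g x := ⟨fun a => x.1 (a.1, a.2 - g), fun a => x.2.1 _, by
    rw [← x.2.2.1]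
    exact Fintype.sum_equiv ((Equiv.refl _).prodCongr (Equiv.subRight g)) _ _ fun a => rfl,
    fun i h h' h1 h2 => sub_left_injective (x.2.2.2 i _ _ h1 h2)⟩
  zero_vadd x := Subtype.ext (funext fun a => congrArg x.1 (by simp))
  add_vadd g h x := Subtype.ext (funext fun a => congrArg x.1 (by
    simp [sub_sub]))

lemma vadd_apply (g : G) (x : chess N G) (i : Fin (N + 1)) (h : G) :
    (g +ᵥ x).1 (i, h) = x.1 (i, h - g) := rfl

lemma dist_vadd_vadd (g : G) (x y : chess N G) : dist (g +ᵥ x) (g +ᵥ y) = dist x y := by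
  have key (g : G) (x y : chess N G) : dist (g +ᵥ x) (g +ᵥ y) ≤ dist x y :=
    (dist_pi_le_iff dist_nonneg).2 fun a => dist_le_pi_dist x.1 y.1 (a.1, a.2 - g)
  refine (key g x y).antisymm ?_
  simpa using key (-g) (g +ᵥ x) (g +ᵥ y)

/-- The join is a free `G`-space: it has a (discontinuous) equivariant map to `G`. -/
lemma exists_equivariant : ∃ π : chess N G → G, ∀ g x, π (g +ᵥ x) = π x + g := by
  let P : chess N G → Set (Fin (N + 1)) := fun x => {i | ∃ h, x.1 (i, h) ≠ 0}
  have hP (x : chess N G) : (P x).Nonempty := exists_ne_zero x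
  have hPg (g : G) (x : chess N G) : P (g +ᵥ x) = P x := by
    ext i
    constructor
    · rintro ⟨h, hh⟩
      exact ⟨_, hh⟩
    · rintro ⟨h, hh⟩
      refine ⟨h + g, ?_⟩
      rwa [vadd_apply, add_sub_cancel_right]
  let c : Set (Fin (N + 1)) → Fin (N + 1) := fun s => Classical.epsilon (· ∈ s)
  have hc (x : chess N G) : c (P x) ∈ P x := Classical.epsilon_spec (hP x)
  choose π hπ using hc
  refine ⟨π, fun g x => ?_⟩
  have h := hπ (g +ᵥ x)
  rw [hPg, vadd_apply] at h
  exact sub_eq_iff_eq_add.1 (x.2.2.2 _ _ _ h (hπ x))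

end Action

/-- Lists of points of the first `k + 1` axes with pairwise distances less than `δ`. -/
def small (N : ℕ) (G : Type*) [Fintype G] (δ : ℝ) (k : ℕ) : Set (List (chess N G)) :=
  {l | (∀ x ∈ l, ∀ i g, x.1 (i, g) ≠ 0 → i.val ≤ k) ∧ ∀ x ∈ l, ∀ y ∈ l, dist x y < δ}

lemma map_vadd_mem_small [AddCommGroup G] {δ : ℝ} {k : ℕ} (g : G) {l : List (chess N G)}
    (hl : l ∈ small N G δ k) : l.map (g +ᵥ ·) ∈ small N G δ k := by
  constructor
  · simp only [List.mem_map, forall_exists_index, and_imp, forall_apply_eq_imp_iff₂]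
    exact fun x hx i h hne => hl.1 x hx i _ hne
  · simp only [List.mem_map, forall_exists_index, and_imp, forall_apply_eq_imp_iff₂]
    intro x hx y hy
    rw [dist_vadd_vadd]
    exact hl.2 x hx y hy

section Fill

variable [Zero G] [DecidableEq G]

/-- The vertex `0` of the `k`-th axis. -/
def vertex (G : Type*) [Fintype G] [Zero G] [DecidableEq G] (k : Fin (N + 1)) : chess N G :=
  ⟨Pi.single (k, 0) 1, fun a => by
      by_cases h : a = (k, 0)
      · subst h; simp
      · simp [h],
    by simp, fun i g h h1 h2 => by
      have h1' : (i, g) = (k, 0) := by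
        by_contra hne
        simp [Pi.single_eq_of_ne hne] at h1
      have h2' : (i, h) = (k, 0) := by
        by_contra hne
        simp [Pi.single_eq_of_ne hne] at h2
      exact congrArg Prod.snd (h1'.trans h2'.symm)⟩

open Classical in
/-- The straight-line homotopy to a vertex, where it makes sense. -/
noncomputable def slide (k : Fin (N + 1)) (t : ℝ) (x : chess N G) : chess N G :=
  if h : (fun a => (1 - t) * x.1 a + t * (vertex G k).1 a) ∈ chess N G then ⟨_, h⟩ else x

lemma slide_apply {k : Fin (N + 1)} {t : ℝ} (ht : t ∈ Set.Icc (0 : ℝ) 1) {x : chess N G}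
    (hx : ∀ i g, x.1 (i, g) ≠ 0 → i < k) (a : Fin (N + 1) × G) :
    (slide k t x).1 a = (1 - t) * x.1 a + t * (vertex G k).1 a := by
  rw [slide, dif_pos]
  refine ⟨fun b => add_nonneg (mul_nonneg (by linarith [ht.2]) (x.2.1 b))
    (mul_nonneg ht.1 ((vertex G k).2.1 b)), ?_, fun i g h h1 h2 => ?_⟩
  · rw [Finset.sum_add_distrib, ← Finset.mul_sum, ← Finset.mul_sum, x.2.2.1, (vertex G k).2.2.1]
    ring
  · by_cases hik : i = k
    · subst hik
      have hx0 (g : G) : x.1 (i, g) = 0 := by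
        by_contra hne
        exact lt_irrefl _ (hx i g hne)
      simp only [hx0, mul_zero, zero_add] at h1 h2
      exact (vertex G i).2.2.2 i g h (right_ne_zero_of_mul h1) (right_ne_zero_of_mul h2)
    · have hv0 (g : G) : (vertex G k).1 (i, g) = 0 :=
        Pi.single_eq_of_ne (fun h => hik (congrArg Prod.fst h)) _
      simp only [hv0, mul_zero, add_zero] at h1 h2
      exact x.2.2.2 i g h (right_ne_zero_of_mul h1) (right_ne_zero_of_mul h2)

lemma dist_slide_le {k : Fin (N + 1)} {s t : ℝ} (hs : s ∈ Set.Icc (0 : ℝ) 1)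
    (ht : t ∈ Set.Icc (0 : ℝ) 1) {x y : chess N G} (hx : ∀ i g, x.1 (i, g) ≠ 0 → i < k)
    (hy : ∀ i g, y.1 (i, g) ≠ 0 → i < k) :
    dist (slide k s x) (slide k t y) ≤ dist x y + |s - t| := by
  refine (dist_pi_le_iff (by positivity)).2 fun a => ?_
  rw [slide_apply hs hx, slide_apply ht hy, Real.dist_eq]
  have h1 : |x.1 a - y.1 a| ≤ dist x y := dist_le_pi_dist x.1 y.1 a
  have h2 : |(vertex G k).1 a - y.1 a| ≤ 1 := by
    rw [abs_le]
    have := (vertex G k).2.1 a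
    have := chess_le_one (vertex G k) a
    have := y.2.1 a
    have := chess_le_one y a
    constructor <;> linarith
  calc |(1 - s) * x.1 a + s * (vertex G k).1 a - ((1 - t) * y.1 a + t * (vertex G k).1 a)|
      = |(1 - s) * (x.1 a - y.1 a) + (s - t) * ((vertex G k).1 a - y.1 a)| := by
        congr 1; ring
    _ ≤ |(1 - s) * (x.1 a - y.1 a)| + |(s - t) * ((vertex G k).1 a - y.1 a)| := abs_add_le _ _
    _ ≤ 1 * dist x y + |s - t| * 1 := by
        rw [abs_mul, abs_mul]
        have h3 : |1 - s| ≤ 1 := by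
          rw [abs_le]
          constructor <;> linarith [hs.1, hs.2]
        gcongr
    _ = dist x y + |s - t| := by ring

lemma exists_bdry_eq_of_small {R : Type*} [CommRing R] {δ : ℝ} (hδ : 0 < δ) {k : ℕ} (hk : k < N)
    (c : List (chess N G) →₀ R) (hc : c ∈ supported R R (small N G δ k)) (hb : bdry c = 0) :
    ∃ b ∈ supported R R (small N G δ (k + 1)), bdry b = c := by
  classical
  have hc' : ∀ l ∈ c.support, l ∈ small N G δ k := fun l hl => (mem_supported R c).1 hc hl
  obtain ⟨M, hM0, hM⟩ : ∃ M : ℕ, 0 < M ∧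
      ∀ l ∈ c.support, ∀ x ∈ l, ∀ y ∈ l, dist x y + 1 / (M : ℝ) < δ := by
    have h : ∀ᶠ M : ℕ in Filter.atTop, ∀ l ∈ c.support, ∀ x ∈ l.toFinset, ∀ y ∈ l.toFinset,
        dist x y + 1 / (M : ℝ) < δ := by
      rw [Filter.eventually_all_finset]
      intro l hl
      rw [Filter.eventually_all_finset]
      intro x hx
      rw [Filter.eventually_all_finset]
      intro y hy
      have hlim : Filter.Tendsto (fun M : ℕ => dist x y + 1 / (M : ℝ)) Filter.atTop
          (nhds (dist x y + 0)) :=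
        tendsto_const_nhds.add tendsto_one_div_atTop_nhds_zero_nat
      rw [add_zero] at hlim
      exact hlim.eventually_lt_const
        ((hc' l hl).2 x (List.mem_toFinset.1 hx) y (List.mem_toFinset.1 hy))
    obtain ⟨M, hM, hM0⟩ := (h.and (Filter.eventually_gt_atTop 0)).exists
    exact ⟨M, hM0, by simpa using hM⟩
  have hM0' : (0 : ℝ) < M := by exact_mod_cast hM0
  let k' : Fin (N + 1) := ⟨k + 1, by omega⟩
  have hlt : ∀ l ∈ c.support, ∀ x ∈ l, ∀ i g, x.1 (i, g) ≠ 0 → i < k' := fun l hl x hx i g h =>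
    Nat.lt_succ_of_le ((hc' l hl).1 x hx i g h)
  have hmem (j : ℕ) (hj : j ≤ M) : (j / M : ℝ) ∈ Set.Icc (0 : ℝ) 1 := by
    refine ⟨by positivity, ?_⟩
    rw [div_le_one hM0']
    exact_mod_cast hj
  have hvert (i : Fin (N + 1)) (g : G) (h : (vertex G k').1 (i, g) ≠ 0) : i.val ≤ k + 1 := by
    by_contra hne
    refine h (Pi.single_eq_of_ne (fun h => hne ?_) _)
    rw [show i = k' from congrArg Prod.fst h]
  refine exists_bdry_eq (S := (c.support : Set (List (chess N G))))
    (fun j => slide k' (j / M)) M (vertex G k') ?_ ?_ ?_ ?_ c ?_ hb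
  · intro l hl x hx
    refine Subtype.ext (funext fun a => ?_)
    rw [slide_apply (hmem 0 (Nat.zero_le _)) (hlt l hl x hx)]
    simp
  · intro l hl x hx
    refine Subtype.ext (funext fun a => ?_)
    rw [slide_apply (hmem M le_rfl) (hlt l hl x hx), div_self hM0'.ne']
    simp
  · intro l hl j hj l' hl'
    have hl'' : ∀ x ∈ l', ∃ y ∈ l, ∃ e : ℕ, (e = j ∨ e = j + 1) ∧ x = slide k' (e / M) y := by
      intro x hx
      obtain ⟨y, hy, h | h⟩ := hl' x hx
      · exact ⟨y, hy, j, Or.inl rfl, h⟩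
      · exact ⟨y, hy, j + 1, Or.inr rfl, h⟩
    constructor
    · intro x hx i g hne
      obtain ⟨y, hy, e, he, rfl⟩ := hl'' x hx
      rw [slide_apply (hmem e (by omega)) (hlt l hl y hy)] at hne
      by_cases h0 : y.1 (i, g) = 0
      · rw [h0, mul_zero, zero_add] at hne
        exact hvert i g (right_ne_zero_of_mul hne)
      · exact ((hc' l hl).1 y hy i g h0).trans (Nat.le_succ k)
    · intro x hx x' hx'
      obtain ⟨y, hy, e, he, rfl⟩ := hl'' x hx
      obtain ⟨y', hy', e', he', rfl⟩ := hl'' x' hx'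
      refine (dist_slide_le (hmem e (by omega)) (hmem e' (by omega)) (hlt l hl y hy)
        (hlt l hl y' hy')).trans_lt (lt_of_le_of_lt ?_ (hM l hl y hy y' hy'))
      rw [← sub_div, abs_div, abs_of_pos hM0']
      gcongr
      rcases he with rfl | rfl <;> rcases he' with rfl | rfl <;> simp
  · intro l hl
    constructor
    · intro x hx i g h
      rw [hl x hx] at h
      exact hvert i g h
    · intro x hx y hy
      rw [hl x hx, hl y hy, dist_self]
      exact hδ
  · exact (mem_supported R c).2 subset_rfl

end Fill

/-- `B` consists of the largest values of `A`. -/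
def IsTop {α : Type*} (A : α → ℝ) (B : Finset α) : Prop := ∀ b ∈ B, ∀ b' ∉ B, A b' < A b

lemma IsTop.eq {α : Type*} {A : α → ℝ} {B B' : Finset α} (h : IsTop A B) (h' : IsTop A B')
    (hcard : B.card = B'.card) : B = B' := by
  by_contra hne
  have h1 : ¬ B ⊆ B' := fun hs => hne (Finset.eq_of_subset_of_card_le hs hcard.ge)
  have h2 : ¬ B' ⊆ B := fun hs => hne (Finset.eq_of_subset_of_card_le hs hcard.le).symm
  obtain ⟨b, hb, hb'⟩ := Finset.not_subset.1 h1
  obtain ⟨c, hc, hc'⟩ := Finset.not_subset.1 h2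
  exact lt_asymm (h b hb c hc') (h' c hc b hb')

variable {p : ℕ} [Fact p.Prime] {n : ℕ}

section Character

lemma card_dotProduct_eq_zero {u : Fin n → ZMod p} (hu : u ≠ 0) :
    p * (Finset.univ.filter fun χ : Fin n → ZMod p => χ ⬝ᵥ u = 0).card = p ^ n := by
  classical
  obtain ⟨j, hj⟩ := Function.ne_iff.1 hu
  let e : Fin n → ZMod p := Pi.single j (u j)⁻¹
  have he : e ⬝ᵥ u = 1 := by
    rw [single_dotProduct]
    exact inv_mul_cancel₀ hj
  have hfib (b : ZMod p) : (Finset.univ.filter fun χ : Fin n → ZMod p => χ ⬝ᵥ u = b).card =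
      (Finset.univ.filter fun χ : Fin n → ZMod p => χ ⬝ᵥ u = 0).card := by
    refine Finset.card_equiv (Equiv.subRight (b • e)) fun χ => ?_
    simp [sub_dotProduct, smul_dotProduct, he, sub_eq_zero]
  have h := Finset.card_eq_sum_card_fiberwise (s := (Finset.univ : Finset (Fin n → ZMod p)))
    (t := (Finset.univ : Finset (ZMod p))) (f := fun χ => χ ⬝ᵥ u)
    (fun _ _ => Finset.mem_coe.2 (Finset.mem_univ _))
  rw [Finset.sum_congr rfl fun b _ => hfib b] at h
  simpa [ZMod.card] using h.symm

/-- The sum of `v` over a fibre of a character. -/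
def fibreSum (χ : Fin n → ZMod p) (v : (Fin n → ZMod p) → ℝ) (b : ZMod p) : ℝ :=
  ∑ h with χ ⬝ᵥ h = b, v h

lemma continuous_fibreSum (χ : Fin n → ZMod p) (b : ZMod p) :
    Continuous fun v : (Fin n → ZMod p) → ℝ => fibreSum χ v b := by
  unfold fibreSum
  fun_prop

lemma fibreSum_shift (χ : Fin n → ZMod p) (v : (Fin n → ZMod p) → ℝ) (g : Fin n → ZMod p)
    (b : ZMod p) : fibreSum χ (fun h => v (h - g)) b = fibreSum χ v (b - χ ⬝ᵥ g) := by
  refine Finset.sum_equiv (Equiv.subRight g) (fun h => ?_) fun h _ => rfl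
  simp [dotProduct_sub]

lemma fibreSum_smul (χ : Fin n → ZMod p) (v : (Fin n → ZMod p) → ℝ) {a : ZMod p} (ha : a ≠ 0)
    (b : ZMod p) : fibreSum (a • χ) v (a * b) = fibreSum χ v b := by
  refine Finset.sum_congr ?_ fun _ _ => rfl
  ext h
  simp [smul_dotProduct, ha]

/-- A function on an elementary abelian group is determined up to a constant by its sums along
hyperplanes. -/
lemma exists_fibreSum_ne {v : (Fin n → ZMod p) → ℝ} {g g' : Fin n → ZMod p} (hv : v g ≠ v g') :
    ∃ χ : Fin n → ZMod p, χ ≠ 0 ∧ ∃ b b', fibreSum χ v b ≠ fibreSum χ v b' := by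
  classical
  by_contra! hcon
  have hp : 1 < (p : ℝ) := by exact_mod_cast (Fact.out : p.Prime).one_lt
  have hS (χ : Fin n → ZMod p) : ∑ b, fibreSum χ v b = ∑ h, v h :=
    Finset.sum_fiberwise _ _ _
  have hA (χ : Fin n → ZMod p) (hχ : χ ≠ 0) (b : ZMod p) : p * fibreSum χ v b = ∑ h, v h := by
    rw [← hS χ, Finset.sum_congr rfl fun b' _ => hcon χ hχ b' b]
    simp [ZMod.card]
  have hindep (g : Fin n → ZMod p) : p * ∑ χ, fibreSum χ v (χ ⬝ᵥ g) =
      p * ∑ χ, fibreSum χ v (χ ⬝ᵥ (0 : Fin n → ZMod p)) := by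
    rw [Finset.mul_sum, Finset.mul_sum]
    refine Finset.sum_congr rfl fun χ _ => ?_
    by_cases hχ : χ = 0
    · simp [hχ]
    · rw [hA χ hχ, hA χ hχ]
  have hcount (g : Fin n → ZMod p) : p * ∑ χ, fibreSum χ v (χ ⬝ᵥ g) =
      p ^ n * (p - 1) * v g + p ^ n * ∑ h, v h := by
    have hcard (h : Fin n → ZMod p) :
        (p : ℝ) * (Finset.univ.filter fun χ : Fin n → ZMod p => χ ⬝ᵥ h = χ ⬝ᵥ g).card =
          if h = g then (p : ℝ) ^ n * p else p ^ n := by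
      have : (Finset.univ.filter fun χ : Fin n → ZMod p => χ ⬝ᵥ h = χ ⬝ᵥ g) =
          Finset.univ.filter fun χ : Fin n → ZMod p => χ ⬝ᵥ (h - g) = 0 := by
        ext χ
        simp [dotProduct_sub, sub_eq_zero]
      rw [this]
      split_ifs with hg
      · simp [hg, ZMod.card, mul_comm]
      · exact_mod_cast card_dotProduct_eq_zero (sub_ne_zero.2 hg)
    have : ∑ χ, fibreSum χ v (χ ⬝ᵥ g) = ∑ h,
        (Finset.univ.filter fun χ : Fin n → ZMod p => χ ⬝ᵥ h = χ ⬝ᵥ g).card * v h := by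
      simp only [fibreSum, Finset.sum_filter]
      rw [Finset.sum_comm]
      refine Finset.sum_congr rfl fun h _ => ?_
      rw [← Finset.sum_filter]
      simp
    rw [this, Finset.mul_sum, Finset.sum_congr rfl fun h _ => by rw [← mul_assoc, hcard h]]
    have hsplit (h : Fin n → ZMod p) : (if h = g then (p : ℝ) ^ n * p else p ^ n) * v h =
        (if h = g then p ^ n * (p - 1) * v h else 0) + p ^ n * v h := by
      split_ifs <;> ring
    rw [Finset.sum_congr rfl fun h _ => hsplit h, Finset.sum_add_distrib, ← Finset.mul_sum]
    simp
  have h := (hcount g).symm.trans ((hindep g).trans ((hindep g').symm.trans (hcount g')))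
  have hne : (p : ℝ) ^ n * (p - 1) ≠ 0 := by
    have : (p : ℝ) - 1 ≠ 0 := by linarith
    positivity
  exact hv (mul_left_cancel₀ hne (add_right_cancel h))

/-- A homogeneous choice of a nonzero coordinate of nonzero vectors. -/
lemma exists_homogeneous : ∃ u : (Fin n → ZMod p) → ZMod p,
    (∀ a χ, a ≠ 0 → u (a • χ) = a * u χ) ∧ ∀ χ, χ ≠ 0 → u χ ≠ 0 := by
  rcases isEmpty_or_nonempty (Fin n) with h | h
  · exact ⟨fun _ => 0, by simp, fun χ hχ => absurd (Subsingleton.elim χ 0) hχ⟩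
  · let c : Set (Fin n) → Fin n := fun s => Classical.epsilon (· ∈ s)
    refine ⟨fun χ => χ (c {j | χ j ≠ 0}), fun a χ ha => ?_, fun χ hχ => ?_⟩
    · have : {j | (a • χ) j ≠ 0} = {j | χ j ≠ 0} := by
        ext j
        simp [ha]
      change (a • χ) (c {j | (a • χ) j ≠ 0}) = _
      rw [this]
      rfl
    · exact Classical.epsilon_spec (p := (· ∈ {j | χ j ≠ 0})) (Function.ne_iff.1 hχ)

lemma exists_isTop {A : ZMod p → ℝ} {b b' : ZMod p} (hb : A b ≠ A b') :
    ∃ B, IsTop A B ∧ B.Nonempty ∧ B.card < p := by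
  classical
  obtain ⟨m, hm⟩ := Finite.exists_max A
  refine ⟨Finset.univ.filter fun c => A c = A m, ?_, ⟨m, by simp⟩, ?_⟩
  · intro c hc c' hc'
    rw [Finset.mem_filter] at hc hc'
    rw [hc.2]
    exact lt_of_le_of_ne (hm c') fun h => hc' ⟨Finset.mem_univ _, h⟩
  · refine lt_of_lt_of_eq (Finset.card_lt_univ_of_notMem (x := if A b = A m then b' else b) ?_)
      (ZMod.card p)
    split_ifs with h
    · simpa [← h] using hb.symm
    · simpa using h

/-- After rescaling the character, the set of top values has a prescribed cardinality. -/
lemma exists_isTop_fibreSum {u : (Fin n → ZMod p) → ZMod p}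
    (hu : ∀ a χ, a ≠ 0 → u (a • χ) = a * u χ) (hu0 : ∀ χ, χ ≠ 0 → u χ ≠ 0)
    {v : (Fin n → ZMod p) → ℝ} {g g' : Fin n → ZMod p} (hv : v g ≠ v g') :
    ∃ χ, χ ≠ 0 ∧ ∃ B, IsTop (fibreSum χ v) B ∧ B.card = (u χ).val := by
  classical
  obtain ⟨χ, hχ, b, b', hb⟩ := exists_fibreSum_ne hv
  obtain ⟨B, hB, hB0, hBp⟩ := exists_isTop hb
  have hBne : (B.card : ZMod p) ≠ 0 := by
    rw [Ne, ZMod.natCast_eq_zero_iff]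
    exact Nat.not_dvd_of_pos_of_lt hB0.card_pos hBp
  let a : ZMod p := B.card * (u χ)⁻¹
  have ha : a ≠ 0 := mul_ne_zero hBne (inv_ne_zero (hu0 χ hχ))
  have hmem (c : ZMod p) : c ∈ B.map (Equiv.mulLeft₀ a ha).toEmbedding ↔ a⁻¹ * c ∈ B := by
    rw [Finset.mem_map_equiv]
    rfl
  refine ⟨a • χ, smul_ne_zero ha hχ, B.map (Equiv.mulLeft₀ a ha).toEmbedding, ?_, ?_⟩
  · intro c hc c' hc'
    rw [hmem] at hc hc'
    have := hB _ hc _ hc'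
    rwa [← fibreSum_smul χ v ha, ← fibreSum_smul χ v ha, mul_inv_cancel_left₀ ha,
      mul_inv_cancel_left₀ ha] at this
  · rw [Finset.card_map, hu a χ ha, mul_assoc, inv_mul_cancel₀ (hu0 χ hχ), mul_one,
      ZMod.val_natCast_of_lt hBp]

end Character

section Selection

variable {X : Type*} [PseudoMetricSpace X] [AddAction (Fin n → ZMod p) X]

/-- The barycentre of the top values gives a locally constant equivariant map on the set of
points around which these do not change. -/
lemma exists_selection (hd : ∀ (g : Fin n → ZMod p) (x y : X), dist (g +ᵥ x) (g +ᵥ y) = dist x y)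
    (χ : Fin n → ZMod p) (A : X → ZMod p → ℝ)
    (hA : ∀ (g : Fin n → ZMod p) x b, A (g +ᵥ x) b = A x (b - χ ⬝ᵥ g)) {w : ZMod p} (hw : w ≠ 0)
    {δ : ℝ} (hδ : 0 < δ) :
    ∃ (U : Set X) (T : X → ZMod p), (∀ (g : Fin n → ZMod p) x, x ∈ U → g +ᵥ x ∈ U) ∧
      (∀ (g : Fin n → ZMod p), ∀ x ∈ U, T (g +ᵥ x) = T x + χ ⬝ᵥ g) ∧
      (∀ x ∈ U, ∀ y ∈ U, dist x y < δ → T x = T y) ∧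
      ∀ x B, B.card = w.val → (∀ y, dist y x < δ → IsTop (A y) B) → x ∈ U := by
  classical
  let Good : X → Finset (ZMod p) → Prop := fun x B =>
    B.card = w.val ∧ ∀ y, dist y x < δ → IsTop (A y) B
  have huniq (x y : X) (B B' : Finset (ZMod p)) (hB : Good x B) (hB' : Good y B')
      (hxy : dist x y < δ) : B = B' :=
    (hB.2 x (by simpa using hδ)).eq (hB'.2 x hxy) (hB.1.trans hB'.1.symm)
  have hshift (g : Fin n → ZMod p) (x : X) (B : Finset (ZMod p)) (hB : Good x B) :
      Good (g +ᵥ x) (B.map (Equiv.addRight (χ ⬝ᵥ g)).toEmbedding) := by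
    refine ⟨by rw [Finset.card_map, hB.1], fun y hy b hb b' hb' => ?_⟩
    rw [Finset.mem_map_equiv] at hb hb'
    have hy' : dist (-g +ᵥ y) x < δ := by
      rwa [← hd g, vadd_neg_vadd]
    have := hB.2 _ hy' _ hb _ hb'
    rw [hA, hA] at this
    simpa using this
  let T : X → ZMod p := fun x => if h : ∃ B, Good x B then w⁻¹ * ∑ b ∈ h.choose, b else 0
  have hT (x : X) (B : Finset (ZMod p)) (hB : Good x B) : T x = w⁻¹ * ∑ b ∈ B, b := by
    have h : ∃ B, Good x B := ⟨B, hB⟩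
    have : h.choose = B := huniq x x _ _ h.choose_spec hB (by simpa using hδ)
    simp only [T]
    rw [dif_pos h, this]
  refine ⟨{x | ∃ B, Good x B}, T, ?_, ?_, ?_, ?_⟩
  · rintro g x ⟨B, hB⟩
    exact ⟨_, hshift g x B hB⟩
  · rintro g x ⟨B, hB⟩
    rw [hT x B hB, hT _ _ (hshift g x B hB), Finset.sum_map]
    simp only [Equiv.coe_toEmbedding, Equiv.coe_addRight, Finset.sum_add_distrib,
      Finset.sum_const, hB.1, nsmul_eq_mul, ZMod.natCast_val, ZMod.cast_id', id_eq, mul_add]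
    rw [inv_mul_cancel_left₀ hw]
  · rintro x ⟨B, hB⟩ y ⟨B', hB'⟩ hxy
    rw [hT x B hB, hT y B' hB', huniq x y B B' hB hB' hxy]
  · exact fun x B h1 h2 => ⟨B, h1, h2⟩

lemma exists_eulerPrim {χ : Fin n → ZMod p} {π : X → Fin n → ZMod p}
    (hπ : ∀ g x, π (g +ᵥ x) = π x + g) {δ : ℝ} {U U' : Set X} {T T' : X → ZMod p}
    (hU : ∀ (g : Fin n → ZMod p) x, x ∈ U → g +ᵥ x ∈ U)
    (hT : ∀ (g : Fin n → ZMod p), ∀ x ∈ U, T (g +ᵥ x) = T x + χ ⬝ᵥ g)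
    (hTδ : ∀ x ∈ U, ∀ y ∈ U, dist x y < δ → T x = T y)
    (hU' : ∀ (g : Fin n → ZMod p) x, x ∈ U' → g +ᵥ x ∈ U')
    (hT' : ∀ (g : Fin n → ZMod p), ∀ x ∈ U', T' (g +ᵥ x) = T' x + χ ⬝ᵥ g)
    (hTδ' : ∀ x ∈ U', ∀ y ∈ U', dist x y < δ → T' x = T' y) :
    ∃ (s : X → ZMod p) (η : X → X → ZMod p), (∀ g x, s (g +ᵥ x) = s x + χ ⬝ᵥ g) ∧
      (∀ (g : Fin n → ZMod p) x y, η (g +ᵥ x) (g +ᵥ y) = η x y) ∧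
      ∀ l : List X, (∀ x ∈ l, ∀ y ∈ l, dist x y < δ) →
        ((∀ x ∈ l, x ∈ U) ∨ ∀ x ∈ l, x ∈ U') →
        ∀ a ∈ l, ∀ b ∈ l, ∀ c ∈ l, coboundary (eulerPrim s η) a b c = 0 := by
  classical
  have hiff {V : Set X} (hV : ∀ (g : Fin n → ZMod p) x, x ∈ V → g +ᵥ x ∈ V)
      (g : Fin n → ZMod p) (x : X) : g +ᵥ x ∈ V ↔ x ∈ V :=
    ⟨fun h => by simpa using hV (-g) _ h, hV g x⟩
  let s : X → ZMod p := fun x => if x ∈ U then T x else if x ∈ U' then T' x else χ ⬝ᵥ π x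
  let η : X → X → ZMod p := fun x y => if x ∈ U ∧ y ∉ U ∧ s x ≠ s y then 1 else 0
  have hs (g : Fin n → ZMod p) (x : X) : s (g +ᵥ x) = s x + χ ⬝ᵥ g := by
    simp only [s, hiff hU, hiff hU']
    split_ifs with h1 h2
    · exact hT g x h1
    · exact hT' g x h2
    · rw [hπ, dotProduct_add]
  refine ⟨s, η, hs, fun g x y => by simp only [η, hiff hU, hs, ne_eq, add_left_inj], ?_⟩
  intro l hl hor a ha b hb c hc
  have hsU (x : X) (hx : x ∈ U) : s x = T x := if_pos hx
  have hform : ∃ ψ : X → ZMod p, ∀ x ∈ l, ∀ y ∈ l, eulerPrim s η x y = ψ y - ψ x := by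
    rcases hor with h | h
    · refine ⟨0, fun x hx y hy => ?_⟩
      have : s x = s y := by
        rw [hsU x (h x hx), hsU y (h y hy), hTδ x (h x hx) y (h y hy) (hl x hx y hy)]
      simp [eulerPrim, carry, η, h y hy, this]
    · by_cases hex : (∃ x ∈ l, x ∈ U) ∧ ∃ y ∈ l, y ∉ U
      · obtain ⟨⟨x₀, hx₀, hx₀U⟩, y₀, hy₀, hy₀U⟩ := hex
        have hsx (x : X) (hx : x ∈ l) : s x = if x ∈ U then s x₀ else s y₀ := by
          split_ifs with hxU
          · rw [hsU x hxU, hsU x₀ hx₀U, hTδ x hxU x₀ hx₀U (hl x hx x₀ hx₀)]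
          · simp only [s, hxU, hy₀U, h x hx, h y₀ hy₀, if_false, if_true]
            exact hTδ' x (h x hx) y₀ (h y₀ hy₀) (hl x hx y₀ hy₀)
        refine ⟨fun x => if x ∈ U ∧ (s x₀).val < (s y₀).val then 1 else 0, fun x hx y hy => ?_⟩
        have hval : s x₀ ≠ s y₀ ↔ (s x₀).val < (s y₀).val ∨ (s y₀).val < (s x₀).val := by
          rw [← (ZMod.val_injective p).ne_iff, ne_iff_lt_or_gt]
        simp only [eulerPrim, carry, η, hsx x hx, hsx y hy]
        by_cases hxU : x ∈ U <;> by_cases hyU : y ∈ U <;> simp [hxU, hyU]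
        by_cases h1 : (s x₀).val < (s y₀).val
        · have : s x₀ ≠ s y₀ := hval.2 (Or.inl h1)
          simp [h1, this, h1.le]
        · by_cases h2 : (s y₀).val < (s x₀).val
          · have : s x₀ ≠ s y₀ := hval.2 (Or.inr h2)
            simp [h1, h2, this]
          · have : s x₀ = s y₀ := by
              by_contra hne
              exact (hval.1 hne).elim h1 h2
            simp [this]
      · refine ⟨0, fun x hx y hy => ?_⟩
        have hxy : x ∈ U ↔ y ∈ U := by
          constructor
          · intro hxU
            by_contra hyU
            exact hex ⟨⟨x, hx, hxU⟩, y, hy, hyU⟩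
          · intro hyU
            by_contra hxU
            exact hex ⟨⟨y, hy, hyU⟩, x, hx, hxU⟩
        have hsxy : s x = s y := by
          by_cases hyU : y ∈ U
          · rw [hsU x (hxy.2 hyU), hsU y hyU, hTδ x (hxy.2 hyU) y hyU (hl x hx y hy)]
          · have hxU : x ∉ U := fun hxU => hyU (hxy.1 hxU)
            simp only [s, hxU, hyU, h x hx, h y hy, if_false, if_true]
            exact hTδ' x (h x hx) y (h y hy) (hl x hx y hy)
        simp [eulerPrim, carry, η, hsxy]
  obtain ⟨ψ, hψ⟩ := hform
  rw [coboundary, hψ b hb c hc, hψ a ha c hc, hψ a ha b hb]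
  ring

end Selection

/-- An equivariant map from a join of copies of an elementary abelian group `G` to
`ℝ^(2 * R × G)` hits the fixed point set when the dimension of the join is at least
`2 |R| (|G| - 1)`. -/
theorem exists_forall_eq {R : Type*} [Fintype R] {N : ℕ}
    (hN : N = 2 * ((p ^ n - 1) * Fintype.card R))
    (F : chess N (Fin n → ZMod p) → R × Bool → (Fin n → ZMod p) → ℝ) (hF : Continuous F)
    (hFg : ∀ (g : Fin n → ZMod p) x k h, F (g +ᵥ x) k h = F x k (h - g)) :
    ∃ x, ∀ k g g', F x k g = F x k g' := by
  classical
  by_contra! hcon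
  obtain ⟨u, hu, hu0⟩ := exists_homogeneous (p := p) (n := n)
  obtain ⟨π, hπ⟩ := exists_equivariant (N := N) (G := Fin n → ZMod p)
  let O : (Fin n → ZMod p) × (R × Bool) × Finset (ZMod p) → Set (chess N (Fin n → ZMod p)) :=
    fun t => {x | t.1 ≠ 0 ∧ t.2.2.card = (u t.1).val ∧
      IsTop (fibreSum t.1 (F x t.2.1)) t.2.2}
  have hO (t) : IsOpen (O t) := by
    have hc (b : ZMod p) : Continuous fun x => fibreSum t.1 (F x t.2.1) b :=
      (continuous_fibreSum t.1 b).comp ((continuous_apply t.2.1).comp hF)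
    have htop : IsOpen {x | IsTop (fibreSum t.1 (F x t.2.1)) t.2.2} := by
      have : {x | IsTop (fibreSum t.1 (F x t.2.1)) t.2.2} = ⋂ b ∈ t.2.2, ⋂ b' ∈ t.2.2ᶜ,
          {x | fibreSum t.1 (F x t.2.1) b' < fibreSum t.1 (F x t.2.1) b} := by
        ext x
        simp [IsTop]
      rw [this]
      exact isOpen_biInter_finset fun b _ => isOpen_biInter_finset fun b' _ =>
        isOpen_lt (hc b') (hc b)
    exact IsOpen.and isOpen_const (IsOpen.and isOpen_const htop)
  have hcover (x : chess N (Fin n → ZMod p)) : ∃ t, x ∈ O t := by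
    obtain ⟨k, g, g', hne⟩ := hcon x
    obtain ⟨χ, hχ, B, hB, hcard⟩ := exists_isTop_fibreSum hu hu0 hne
    exact ⟨(χ, k, B), hχ, hcard, hB⟩
  obtain ⟨δ, hδ, hleb⟩ := lebesgue_number_lemma_of_metric
    (isCompact_univ (X := chess N (Fin n → ZMod p))) hO
    fun x _ => Set.mem_iUnion.2 (hcover x)
  have hδ2 : 0 < δ / 2 := half_pos hδ
  have hsel (χ : {χ : Fin n → ZMod p // χ ≠ 0}) (k : R × Bool) :=
    exists_selection (dist_vadd_vadd (N := N)) χ.1 (fun x => fibreSum χ.1 (F x k))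
      (fun g x b => by
        rw [← fibreSum_shift]
        exact congrArg (fibreSum χ.1 · b) (funext fun h => hFg g x k h)) (hu0 χ.1 χ.2) hδ2
  choose U T hU hT hTδ hmem using hsel
  have hprim (i : {χ : Fin n → ZMod p // χ ≠ 0} × R) :=
    exists_eulerPrim hπ (hU i.1 (i.2, false)) (hT i.1 (i.2, false)) (hTδ i.1 (i.2, false))
      (hU i.1 (i.2, true)) (hT i.1 (i.2, true)) (hTδ i.1 (i.2, true))
  choose s η hs hη hzero using hprim
  have : Nonempty (chess N (Fin n → ZMod p)) := ⟨vertex _ 0⟩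
  obtain ⟨t₀, ht₀⟩ := hcover (vertex _ 0)
  obtain ⟨l, hl, hne⟩ := exists_mem_forall_coboundary_ne_zero
    (ι := {χ : Fin n → ZMod p // χ ≠ 0} × R) (χ := fun i => i.1.1) (s := s) (η := η)
    (fun i => i.1.2) hs hη (small N _ (δ / 2)) N
    (by
      rw [hN, Fintype.card_prod, Fintype.card_subtype_compl, Fintype.card_subtype_eq]
      simp [ZMod.card])
    (fun k g l hl => map_vadd_mem_small g hl)
    (fun k hk c hc hb => exists_bdry_eq_of_small hδ2 hk c hc hb) (vertex _ 0)
    ⟨fun x hx i g h => by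
        rw [List.mem_singleton.1 hx] at h
        by_contra hi
        refine h (Pi.single_eq_of_ne (fun h => hi ?_) _)
        rw [show i = 0 from congrArg Prod.fst h]
        rfl,
      fun x hx y hy => by
        rw [List.mem_singleton.1 hx, List.mem_singleton.1 hy, dist_self]
        exact hδ2⟩
  obtain ⟨a, ha, -⟩ := hne (⟨t₀.1, ht₀.1⟩, t₀.2.1.1)
  obtain ⟨⟨χ, ⟨i, e⟩, B⟩, hball⟩ := hleb a (Set.mem_univ a)
  have hχ := hball (Metric.mem_ball_self hδ)
  have hlU : ∀ x ∈ l, x ∈ U ⟨χ, hχ.1⟩ (i, e) := fun x hx =>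
    hmem ⟨χ, hχ.1⟩ (i, e) x B hχ.2.1 fun y hy => (hball (by
      rw [Metric.mem_ball]
      have := dist_triangle y x a
      have := hl.2 x hx a ha
      linarith)).2.2
  obtain ⟨x, hx, y, hy, w, hw, h⟩ := hne (⟨χ, hχ.1⟩, i)
  refine h (hzero (⟨χ, hχ.1⟩, i) l hl.2 ?_ x hx y hy w hw)
  cases e
  · exact Or.inl hlU
  · exact Or.inr hlU

section Retraction

variable {V : Type*} [Fintype V] [DecidableEq V]

/-- A retraction of the nonnegative orthant to the standard simplex. -/
noncomputable def retract (v₀ : V) (y : V → ℝ) : V → ℝ := fun v =>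
  (y v + if v = v₀ then max 0 (1 - ∑ w, y w) else 0) / max 1 (∑ w, y w)

lemma continuous_retract (v₀ : V) : Continuous (retract v₀) := by
  refine continuous_pi fun v => Continuous.div ?_ (by fun_prop) fun y =>
    (lt_of_lt_of_le one_pos (le_max_left _ _)).ne'
  split_ifs <;> fun_prop

lemma retract_mem (v₀ : V) {y : V → ℝ} (hy : ∀ v, 0 ≤ y v) :
    retract v₀ y ∈ stdSimplex ℝ V := by
  have hpos : 0 < max 1 (∑ w, y w) := lt_of_lt_of_le one_pos (le_max_left _ _)
  refine ⟨fun v => div_nonneg (add_nonneg (hy v) ?_) hpos.le, ?_⟩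
  · split_ifs <;> simp
  · simp only [retract]
    rw [← Finset.sum_div, div_eq_one_iff_eq hpos.ne', Finset.sum_add_distrib,
      Finset.sum_ite_eq' Finset.univ v₀, if_pos (Finset.mem_univ _), ← max_add_add_left,
      add_zero, add_sub_cancel, max_comm]

lemma retract_eq_self (v₀ : V) {y : V → ℝ} (hy : y ∈ stdSimplex ℝ V) : retract v₀ y = y := by
  funext v
  simp [retract, hy.2]

end Retraction

/-- **Topological Tverberg theorem** for prime powers. -/
theorem topological_tverberg {p n d : ℕ} [Fact p.Prime] {V : Type*} [Fintype V]
    (hV : Fintype.card V = (p ^ n - 1) * (d + 1) + 1) (f : (V → ℝ) → (Fin d → ℝ))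
    (hf : ContinuousOn f (stdSimplex ℝ V)) :
    ∃ x : (Fin n → ZMod p) → V → ℝ, (∀ g, x g ∈ stdSimplex ℝ V) ∧
      (∀ g h v, x g v ≠ 0 → x h v ≠ 0 → g = h) ∧ ∀ g h, f (x g) = f (x h) := by
  classical
  have hm : 0 < p ^ n := pow_pos (Fact.out : p.Prime).pos n
  have hG : Fintype.card (Fin n → ZMod p) = p ^ n := by simp [ZMod.card]
  obtain ⟨v₀⟩ : Nonempty V := Fintype.card_pos_iff.1 (by omega)
  let N := 2 * ((p ^ n - 1) * (d + 1))
  have hcard : Fintype.card (V ⊕ (Fin (d + 1) × Fin (p ^ n - 1))) = N + 1 := by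
    rw [Fintype.card_sum, hV, Fintype.card_prod, Fintype.card_fin, Fintype.card_fin]
    simp only [N]
    ring
  let e : V ⊕ (Fin (d + 1) × Fin (p ^ n - 1)) ≃ Fin (N + 1) := Fintype.equivFinOfCardEq hcard
  let part : chess N (Fin n → ZMod p) → (Fin n → ZMod p) → V → ℝ := fun x g v =>
    x.1 (e (Sum.inl v), g)
  have hpart : Continuous part := continuous_pi fun g => continuous_pi fun v =>
    (continuous_apply _).comp continuous_subtype_val
  let big : (Fin n → ZMod p) → chess N (Fin n → ZMod p) → V → ℝ := fun g x =>
    retract v₀ ((p ^ n : ℝ) • part x g)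
  have hbig (g) : Continuous (big g) := by
    have hg : Continuous fun x => part x g := (continuous_apply g).comp hpart
    exact (continuous_retract v₀).comp (hg.const_smul (p ^ n : ℝ))
  have hbigmem (g x) : big g x ∈ stdSimplex ℝ V :=
    retract_mem v₀ fun v => mul_nonneg (by positivity) (x.2.1 _)
  let F : chess N (Fin n → ZMod p) → Fin (d + 1) × Bool → (Fin n → ZMod p) → ℝ := fun x k g =>
    bif k.2 then ∑ j, x.1 (e (Sum.inr (k.1, j)), g) else
      Fin.cases (∑ v, part x g v) (fun i => f (big g x) i) k.1
  have hF : Continuous F := by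
    refine continuous_pi fun k => continuous_pi fun g => ?_
    obtain ⟨k, b⟩ := k
    cases b
    · refine Fin.cases ?_ (fun i => ?_) k
      · exact continuous_finsetSum _ fun v _ =>
          (continuous_apply v).comp ((continuous_apply g).comp hpart)
      · exact (continuous_apply i).comp (hf.comp_continuous (hbig g) (hbigmem g))
    · exact continuous_finsetSum _ fun j _ =>
        (continuous_apply _).comp continuous_subtype_val
  obtain ⟨x, hx⟩ := exists_forall_eq (R := Fin (d + 1)) (N := N) (by simp [N]) F hF
    (fun g x k h => by
      obtain ⟨k, b⟩ := k
      cases b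
      · refine Fin.cases ?_ (fun i => ?_) k <;> rfl
      · rfl)
  have hextra (k : Fin (d + 1)) (g : Fin n → ZMod p) :
      ∑ j, x.1 (e (Sum.inr (k, j)), g) = 0 := by
    by_contra hne
    have hne' (h : Fin n → ZMod p) : ∃ j, x.1 (e (Sum.inr (k, j)), h) ≠ 0 := by
      by_contra! h0
      exact hne ((hx (k, true) g h).trans (Finset.sum_eq_zero fun j _ => h0 j))
    choose j hj using hne'
    have hinj : Function.Injective j := fun h h' hh =>
      x.2.2.2 _ h h' (hj h) (by rw [hh]; exact hj h')
    have := Fintype.card_le_of_injective j hinj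
    rw [hG, Fintype.card_fin] at this
    omega
  have hweight (g : Fin n → ZMod p) : (p ^ n : ℝ) * ∑ v, part x g v = 1 := by
    have h := x.2.2.1
    rw [Fintype.sum_prod_type_right] at h
    have hg (h : Fin n → ZMod p) : ∑ a, x.1 (a, h) = ∑ v, part x g v := by
      rw [← e.sum_comp, Fintype.sum_sum_type, Fintype.sum_prod_type,
        Finset.sum_eq_zero fun k _ => hextra k h, add_zero]
      exact hx (0, false) h g
    rw [Finset.sum_congr rfl fun h _ => hg h, Finset.sum_const, Finset.card_univ, hG,
      nsmul_eq_mul] at h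
    exact_mod_cast h
  have hmem (g : Fin n → ZMod p) : (p ^ n : ℝ) • part x g ∈ stdSimplex ℝ V := by
    refine ⟨fun v => mul_nonneg (by positivity) (x.2.1 _), ?_⟩
    rw [← hweight g, Finset.mul_sum]
    rfl
  refine ⟨fun g => (p ^ n : ℝ) • part x g, hmem, fun g h v h1 h2 =>
    x.2.2.2 _ g h (right_ne_zero_of_mul h1) (right_ne_zero_of_mul h2), fun g h => ?_⟩
  funext i
  have h' : f (big g x) i = f (big h x) i := hx (i.succ, false) g h
  simpa only [big, retract_eq_self v₀ (hmem _)] using h'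

section Pushforward

variable {V W : Type*} [Fintype V] [DecidableEq W]

/-- The affine map induced by a map of vertices. -/
def push (ε : V → W) (y : V → ℝ) : W → ℝ := fun a => ∑ v, if ε v = a then y v else 0

lemma continuous_push (ε : V → W) : Continuous (push ε) :=
  continuous_pi fun a => continuous_finsetSum _ fun v _ => by
    split_ifs <;> fun_prop

lemma push_mem [Fintype W] (ε : V → W) {y : V → ℝ} (hy : y ∈ stdSimplex ℝ V) :
    push ε y ∈ stdSimplex ℝ W := by
  refine ⟨fun a => Finset.sum_nonneg fun v _ => ?_, ?_⟩
  · split_ifs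
    · exact hy.1 v
    · exact le_rfl
  · simp only [push]
    rw [Finset.sum_comm, ← hy.2]
    simp

lemma push_eq_zero {ε : V → W} {y : V → ℝ} {a : W} (h : ∀ v, y v ≠ 0 → ε v ≠ a) :
    push ε y a = 0 :=
  Finset.sum_eq_zero fun v _ => by
    split_ifs with hv
    · by_contra hne
      exact h v hne hv
    · rfl

end Pushforward

end ChessJoin

/-- **Topological Tverberg type theorem for an arbitrary natural number `r`.**
Let `r ≥ 2`, `d ≥ 1`, `N = (r-1)(d+1)` and let `r = p_1^{n_1} ⋯ p_k^{n_k}` be the prime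
factorization of `r`, `r_j = p_j^{n_j}`, `q_j = r / r_j`.  Then for every continuous map
`f : Δ_N → ℝ^d` and every `j`, there are `r = q_j r_j` pairwise disjoint closed faces of
`Δ_N`, grouped as `{σ_{i_1}, …, σ_{i_{r_j}}}_{i=1}^{q_j}`, such that
`f(σ_{i_1}) ∩ ⋯ ∩ f(σ_{i_{r_j}}) ≠ ∅` for each `i`. -/
theorem stmt9 (r d : ℕ) (hr : 2 ≤ r) (hd : 1 ≤ d) (N : ℕ) (hN : N = (r - 1) * (d + 1))
    (k : ℕ) (pp nn : Fin k → ℕ) (hpp : ∀ j, (pp j).Prime) (hnn : ∀ j, 1 ≤ nn j)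
    (hinj : Function.Injective pp) (hfac : r = ∏ j, pp j ^ nn j)
    (f : (Fin (N + 1) → ℝ) → (Fin d → ℝ)) (hf : ContinuousOn f (stdSimplex ℝ (Fin (N + 1))))
    (j : Fin k) :
    ∃ σ : Fin (r / pp j ^ nn j) → Fin (pp j ^ nn j) → Finset (Fin (N + 1)),
      (∀ i s i' s', (i, s) ≠ (i', s') → Disjoint (σ i s) (σ i' s')) ∧
      ∀ i, (⋂ s, f '' face N (σ i s)).Nonempty := by
  have : Fact (pp j).Prime := ⟨hpp j⟩
  have hdvd : pp j ^ nn j ∣ r := hfac ▸ Finset.dvd_prod_of_mem _ (Finset.mem_univ j)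
  have hm : 0 < pp j ^ nn j := pow_pos (hpp j).pos _
  let G := Fin (nn j) → ZMod (pp j)
  let V := Fin ((pp j ^ nn j - 1) * (d + 1) + 1)
  let E : Fin (pp j ^ nn j) ≃ G := (Fintype.equivFinOfCardEq (by simp [G, ZMod.card])).symm
  have hcard : Fintype.card (Fin (r / pp j ^ nn j) × V) ≤ Fintype.card (Fin (N + 1)) := by
    rw [Fintype.card_prod, Fintype.card_fin, Fintype.card_fin, Fintype.card_fin, hN]
    obtain ⟨q, hq⟩ := hdvd
    have hq0 : 1 ≤ q := by
      rcases Nat.eq_zero_or_pos q with h | h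
      · rw [h, mul_zero] at hq; omega
      · exact h
    rw [hq, Nat.mul_div_cancel_left q hm]
    generalize pp j ^ nn j = m at hm hq
    obtain ⟨m, rfl⟩ := Nat.exists_eq_succ_of_ne_zero hm.ne'
    obtain ⟨q, rfl⟩ := Nat.exists_eq_succ_of_ne_zero (Nat.one_le_iff_ne_zero.1 hq0)
    have : (m + 1) * (q + 1) - 1 = m * q + m + q := by
      rw [show (m + 1) * (q + 1) = m * q + m + q + 1 by ring, Nat.add_sub_cancel]
    simp only [Nat.succ_eq_add_one, this, Nat.add_sub_cancel]
    nlinarith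
  obtain ⟨ε⟩ := Function.Embedding.nonempty_of_card_le hcard
  have hcore (i : Fin (r / pp j ^ nn j)) :=
    ChessJoin.topological_tverberg (p := pp j) (n := nn j) (V := V) (by simp [V])
      (fun y => f (ChessJoin.push (fun v => ε (i, v)) y))
      (hf.comp (ChessJoin.continuous_push _).continuousOn fun y hy => ChessJoin.push_mem _ hy)
  choose x hx hdisj heq using hcore
  refine ⟨fun i s => (Finset.univ.filter fun v => x i (E s) v ≠ 0).image fun v => ε (i, v),
    ?_, fun i => ?_⟩
  · intro i s i' s' hne
    rw [Finset.disjoint_left]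
    intro a ha ha'
    simp only [Finset.mem_image, Finset.mem_filter, Finset.mem_univ, true_and] at ha ha'
    obtain ⟨v, hv, rfl⟩ := ha
    obtain ⟨v', hv', h⟩ := ha'
    obtain ⟨rfl, rfl⟩ := Prod.mk.inj (ε.injective h)
    exact hne (Prod.ext rfl (E.injective (hdisj _ _ _ _ hv hv')))
  · refine ⟨f (ChessJoin.push (fun v => ε (i, v)) (x i 0)), Set.mem_iInter.2 fun s => ?_⟩
    refine ⟨_, ⟨ChessJoin.push_mem _ (hx i (E s)), fun a ha => ?_⟩, heq i (E s) 0⟩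
    refine ChessJoin.push_eq_zero fun v hv hva => ha ?_
    simp only [Finset.mem_image, Finset.mem_filter, Finset.mem_univ, true_and]
    exact ⟨v, hv, hva⟩
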